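/- arXiv:2108.06864 — 2 statements merged into one kernel-verified Lean document; each statement's English description precedes it below -/
import Mathlib

section
/- (Lemma 6.3) Let S = {1,…,s} and L, K ⊂ S with |L|, |K| ≤ s − n. If 0 ≤ l ≤ 2(s−n) − |L| − |K| − 1, then Σ_{N ⊂ S∖L, |N|=n} Σ_{J ⊂ S∖K, |J|=n} ε(N,J) 𝒜(N,J) ∂̄^l 𝒜(S∖N, S∖J) lies in the ideal 𝔯[n+1] of ℤ[x_{ij}^{(k)}] generated by all (n+1)-minors and their normalized derivatives. -/
open MvPolynomial

/-- `ℤ[x_{ij}^{(k)} : i,j ∈ S = {1,…,s}, k ≥ 0]`. -/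
abbrev PolyS (s : ℕ) := MvPolynomial (Fin s × Fin s × ℕ) ℤ

/-- The full derivation `∂` with `∂x_{ij}^{(k)} = (k+1)x_{ij}^{(k+1)}`. -/
noncomputable def dFull (s : ℕ) : Derivation ℤ (PolyS s) (PolyS s) :=
  mkDerivation ℤ fun v => ((v.2.2 : ℤ) + 1) • X (v.1, v.2.1, v.2.2 + 1)

/-- The row derivation `∂_l`, acting only on row `l`:
`∂_l x_{ij}^{(k)} = δ_i^l (k+1) x_{ij}^{(k+1)}`. -/
noncomputable def dRow (s : ℕ) (l : Fin s) : Derivation ℤ (PolyS s) (PolyS s) :=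
  mkDerivation ℤ fun v =>
    if v.1 = l then ((v.2.2 : ℤ) + 1) • X (v.1, v.2.1, v.2.2 + 1) else 0

/-- The column derivation `(∂_*)_l`, acting only on column `l`. -/
noncomputable def dCol (s : ℕ) (l : Fin s) : Derivation ℤ (PolyS s) (PolyS s) :=
  mkDerivation ℤ fun v =>
    if v.2.1 = l then ((v.2.2 : ℤ) + 1) • X (v.1, v.2.1, v.2.2 + 1) else 0

/-- `∂_N = Σ_{l ∈ N} ∂_l`. -/
noncomputable def dRowSet (s : ℕ) (N : Finset (Fin s)) :
    Derivation ℤ (PolyS s) (PolyS s) :=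
  ∑ l ∈ N, dRow s l

/-- `(∂_*)_N = Σ_{l ∈ N} (∂_*)_l`. -/
noncomputable def dColSet (s : ℕ) (N : Finset (Fin s)) :
    Derivation ℤ (PolyS s) (PolyS s) :=
  ∑ l ∈ N, dCol s l

/-- The minor `𝒜(I,K) = det (x_{ij}^{(0)})_{i∈I, j∈K}`, rows and columns taken in
increasing order (and `0` if `|I| ≠ |K|`). -/
noncomputable def minorA (s : ℕ) (I K : Finset (Fin s)) : PolyS s :=
  if h : K.card = I.card then
    (Matrix.of fun a b : Fin I.card =>
      (X ((I.orderIsoOfFin rfl a : Fin s), (K.orderIsoOfFin h b : Fin s), 0) :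
        PolyS s)).det
  else 0

/-- `ε(I,K) = (−1)^{Σ_{i∈I} i + Σ_{j∈K} j}` (indices counted `1,…,s`). -/
def epsSign (s : ℕ) (I K : Finset (Fin s)) : ℤ :=
  (-1) ^ (∑ i ∈ I, ((i : ℕ) + 1) + ∑ j ∈ K, ((j : ℕ) + 1))

/-- The ideal `𝔯[m]` generated by all `m`-minors and their normalized derivatives
(characterized by `n! • g = ∂^n 𝒜(I,K)`). -/
noncomputable def minorIdealS (s m : ℕ) : Ideal (PolyS s) :=
  Ideal.span {g | ∃ (n : ℕ) (I K : Finset (Fin s)), I.card = m ∧ K.card = m ∧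
    (n.factorial : ℤ) • g = (⇑(dFull s))^[n] (minorA s I K)}

/-- The sign of a permutation is the product of the signs of its inversions. -/
theorem sign_eq_prod_inversions {s : ℕ} (ρ : Equiv.Perm (Fin s)) :
    ((Equiv.Perm.sign ρ : ℤˣ) : ℤ) =
      ∏ i, ∏ j, if i < j then (if ρ j < ρ i then -1 else 1) else 1 := by
  have h := Matrix.det_permute ρ (Matrix.vandermonde fun i : Fin s => ((i : ℕ) : ℤ))
  have h1 : (Matrix.vandermonde fun i : Fin s => ((i : ℕ) : ℤ)).submatrix ρ id =
      Matrix.vandermonde fun i : Fin s => ((ρ i : ℕ) : ℤ) := by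
    ext i j; simp [Matrix.vandermonde]
  rw [h1, Matrix.det_vandermonde, Matrix.det_vandermonde] at h
  have h2 := congrArg Int.sign h
  have key : ∀ v : Fin s → ℤ, Int.sign (∏ i, ∏ j ∈ Finset.Ioi i, (v j - v i)) =
      ∏ i, ∏ j, if i < j then Int.sign (v j - v i) else 1 := by
    intro v
    let sg : ℤ →* ℤ := ⟨⟨Int.sign, rfl⟩, Int.sign_mul⟩
    change sg _ = _
    rw [map_prod]
    refine Finset.prod_congr rfl fun i _ => ?_
    rw [map_prod, ← Finset.prod_filter]
    refine Finset.prod_congr ?_ fun _ _ => rfl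
    ext j; simp
  rw [Int.sign_mul, key, key] at h2
  have h3 : (∏ i : Fin s, ∏ j : Fin s,
      if i < j then Int.sign (((j : ℕ) : ℤ) - ((i : ℕ) : ℤ)) else 1) = 1 := by
    refine Finset.prod_eq_one fun i _ => Finset.prod_eq_one fun j _ => ?_
    split_ifs with hij
    · rw [Int.sign_eq_one_iff_pos]
      have : (i : ℕ) < j := hij
      omega
    · rfl
  rw [h3, mul_one] at h2
  have h4 : Int.sign ((Equiv.Perm.sign ρ : ℤˣ) : ℤ) = Equiv.Perm.sign ρ := by
    rcases Int.units_eq_one_or (Equiv.Perm.sign ρ) with h | h <;> simp [h]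
  simp only [Int.cast_id] at h2
  rw [h4] at h2
  rw [← h2]
  refine Finset.prod_congr rfl fun i _ => Finset.prod_congr rfl fun j _ => ?_
  split_ifs with hij h5
  · rw [Int.sign_eq_neg_one_iff_neg]
    have : (ρ j : ℕ) < ρ i := h5
    omega
  · rw [Int.sign_eq_one_iff_pos]
    have : ρ i ≠ ρ j := fun h => hij.ne (ρ.injective h)
    have : (ρ i : ℕ) ≠ ρ j := fun h => this (Fin.ext h)
    have : ¬ (ρ j : ℕ) < ρ i := h5
    omega
  · rfl

/-- A permutation carrying `N` onto `J` and increasing on `N` and on its complement has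
sign `ε(N, J)`. -/
theorem sign_eq_epsSign {s : ℕ} (N J : Finset (Fin s)) (ρ : Equiv.Perm (Fin s))
    (hρ : ∀ i, ρ i ∈ J ↔ i ∈ N)
    (hN : ∀ i ∈ N, ∀ j ∈ N, i < j → ρ i < ρ j)
    (hN' : ∀ i ∉ N, ∀ j ∉ N, i < j → ρ i < ρ j) :
    ((Equiv.Perm.sign ρ : ℤˣ) : ℤ) = epsSign s N J := by
  classical
  let t : Fin s → Fin s → ℤ := fun i j => if j < i then -1 else 1
  have tt : ∀ i j, t i j * t i j = 1 := by intro i j; simp only [t]; split_ifs <;> simp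
  have ts : ∀ i j, i ≠ j → t i j = - t j i := by
    intro i j hij
    rcases lt_or_gt_of_ne hij with h | h <;> simp [t, h, h.not_gt]
  have hF : ∀ i j, i < j → t i j = 1 := by intro i j hij; simp [t, hij.not_gt]
  have trow : ∀ i : Fin s, ∏ j, t i j = (-1) ^ (i : ℕ) := by
    intro i
    simp only [t]
    rw [← Finset.prod_filter, Finset.prod_const]
    congr 1
    have : Finset.univ.filter (fun j => j < i) = Finset.Iio i := by ext; simp
    rw [this, Fin.card_Iio]
  have hq : ∀ I : Finset (Fin s), (∏ i ∈ I, ∏ j ∈ Iᶜ, t i j) * (∏ i ∈ I, ∏ j ∈ I, t i j) =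
      (-1) ^ (∑ i ∈ I, (i : ℕ)) := by
    intro I
    rw [← Finset.prod_mul_distrib, ← Finset.prod_pow_eq_pow_sum]
    refine Finset.prod_congr rfl fun i _ => ?_
    rw [← trow, mul_comm, Finset.prod_mul_prod_compl]
  have hJ : ∀ f : Fin s → ℤ, ∏ i ∈ J, f i = ∏ i ∈ N, f (ρ i) := by
    intro f
    exact (Finset.prod_equiv ρ (fun i => (hρ i).symm) fun _ _ => rfl).symm
  have hJc : ∀ f : Fin s → ℤ, ∏ i ∈ Jᶜ, f i = ∏ i ∈ Nᶜ, f (ρ i) := by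
    intro f
    refine (Finset.prod_equiv ρ (fun i => ?_) fun _ _ => rfl).symm
    simp [hρ]
  have hcard : J.card = N.card :=
    (Finset.card_equiv ρ fun i => (hρ i).symm).symm
  have hpp : (∏ i ∈ J, ∏ j ∈ J, t i j) = ∏ i ∈ N, ∏ j ∈ N, t i j := by
    rw [hJ]
    refine Finset.prod_congr rfl fun i hi => ?_
    rw [hJ]
    refine Finset.prod_congr rfl fun j hj => ?_
    rcases lt_trichotomy i j with h | h | h
    · rw [hF _ _ h, hF _ _ (hN i hi j hj h)]
    · subst h; simp [t]
    · simp [t, h, hN j hj i hi h]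
  have hp2 : (∏ i ∈ N, ∏ j ∈ N, t i j) * (∏ i ∈ N, ∏ j ∈ N, t i j) = 1 := by
    simp only [← Finset.prod_mul_distrib, tt, Finset.prod_const_one]
  have hsplit : ((Equiv.Perm.sign ρ : ℤˣ) : ℤ) =
      (∏ i ∈ N, ∏ j ∈ Nᶜ, t i j) * (∏ i ∈ J, ∏ j ∈ Jᶜ, t i j) := by
    rw [sign_eq_prod_inversions, hJ]
    simp only [hJc]
    simp only [← Finset.prod_mul_distrib]
    rw [← Finset.prod_mul_prod_compl N]
    have e1 : ∀ i ∈ N, (∏ j, if i < j then (if ρ j < ρ i then (-1 : ℤ) else 1) else 1) =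
        ∏ j ∈ Nᶜ, if i < j then (if ρ j < ρ i then (-1 : ℤ) else 1) else 1 := by
      intro i hi
      rw [← Finset.prod_mul_prod_compl N, Finset.prod_eq_one, one_mul]
      intro j hj
      split_ifs with h1 h2
      · exact absurd h2 (hN i hi j hj h1).not_gt
      · rfl
      · rfl
    have e2 : ∀ i ∈ Nᶜ, (∏ j, if i < j then (if ρ j < ρ i then (-1 : ℤ) else 1) else 1) =
        ∏ j ∈ N, if i < j then (if ρ j < ρ i then (-1 : ℤ) else 1) else 1 := by
      intro i hi
      rw [← Finset.prod_mul_prod_compl N, mul_comm, Finset.prod_eq_one, one_mul]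
      intro j hj
      split_ifs with h1 h2
      · exact absurd h2 (hN' i (by simpa using hi) j (by simpa using hj) h1).not_gt
      · rfl
      · rfl
    rw [Finset.prod_congr rfl e1, Finset.prod_congr rfl e2, Finset.prod_comm (s := Nᶜ),
      ← Finset.prod_mul_distrib]
    refine Finset.prod_congr rfl fun i hi => ?_
    rw [← Finset.prod_mul_distrib]
    refine Finset.prod_congr rfl fun j hj => ?_
    have hij : i ≠ j := by rintro rfl; simp [hi] at hj
    have hρij : ρ i ≠ ρ j := fun h => hij (ρ.injective h)
    rcases lt_or_gt_of_ne hij with h | h <;> rcases lt_or_gt_of_ne hρij with h' | h' <;>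
      simp [t, h, h.not_gt, h', h'.not_gt]
  have hsum : ∀ I : Finset (Fin s), ∑ i ∈ I, ((i : ℕ) + 1) = ∑ i ∈ I, (i : ℕ) + I.card := by
    intro I; simp [Finset.sum_add_distrib]
  rw [hsplit, epsSign, hsum, hsum, hcard,
    show ∑ i ∈ N, (i : ℕ) + N.card + (∑ i ∈ J, (i : ℕ) + N.card) =
      ∑ i ∈ N, (i : ℕ) + ∑ i ∈ J, (i : ℕ) + 2 * N.card by ring, pow_add, pow_add, pow_mul,
    ← hq, ← hq, hpp]
  simp only [neg_one_sq, one_pow, mul_one]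
  linear_combination (-(∏ i ∈ N, ∏ j ∈ Nᶜ, t i j) * (∏ i ∈ J, ∏ j ∈ Jᶜ, t i j)) * hp2

/-- The minor of `M` with rows `I` and columns `K`, both in increasing order (and `0` if
`|I| ≠ |K|`). -/
def sortedMinor {s : ℕ} {R : Type*} [CommRing R] (M : Matrix (Fin s) (Fin s) R)
    (I K : Finset (Fin s)) : R :=
  if h : K.card = I.card then
    (M.submatrix (I.orderEmbOfFin rfl) (K.orderEmbOfFin h)).det
  else 0

theorem minorA_eq_sortedMinor (s : ℕ) (I K : Finset (Fin s)) :
    minorA s I K = sortedMinor (Matrix.of fun i j : Fin s => (X (i, j, 0) : PolyS s)) I K :=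
  rfl

theorem map_sortedMinor {s : ℕ} {R R' : Type*} [CommRing R] [CommRing R'] (φ : R →+* R')
    (M : Matrix (Fin s) (Fin s) R) (I K : Finset (Fin s)) :
    φ (sortedMinor M I K) = sortedMinor (M.map φ) I K := by
  unfold sortedMinor
  split_ifs
  · rw [RingHom.map_det]; rfl
  · simp

/-- Pairing the rows in `N` with the columns in `J` through increasing enumerations, and the
complements likewise. -/
theorem exists_perm_orderEmbOfFin {s : ℕ} (N J : Finset (Fin s)) (h : J.card = N.card)
    (hc : Jᶜ.card = Nᶜ.card) :
    ∃ ρ : Equiv.Perm (Fin s),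
      (∀ a, ρ (N.orderEmbOfFin rfl a) = J.orderEmbOfFin h a) ∧
      (∀ a, ρ (Nᶜ.orderEmbOfFin rfl a) = Jᶜ.orderEmbOfFin hc a) := by
  refine ⟨(finSumEquivOfFinset (s := N) rfl rfl).symm.trans (finSumEquivOfFinset h hc), ?_, ?_⟩
  · intro a
    rw [← finSumEquivOfFinset_inl (s := N) rfl rfl, Equiv.trans_apply, Equiv.symm_apply_apply,
      finSumEquivOfFinset_inl]
  · intro a
    rw [← finSumEquivOfFinset_inr (s := N) rfl rfl, Equiv.trans_apply, Equiv.symm_apply_apply,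
      finSumEquivOfFinset_inr]

/-- The determinant of a matrix supported on `N × J` and `Nᶜ × Jᶜ`. -/
theorem det_two_blocks {s : ℕ} {R : Type*} [CommRing R] (A B : Matrix (Fin s) (Fin s) R)
    (N J : Finset (Fin s)) :
    (Matrix.of fun i j => if j ∈ J then (if i ∈ N then A i j else 0)
      else (if i ∈ N then 0 else B i j)).det =
      epsSign s N J • (sortedMinor A N J * sortedMinor B Nᶜ Jᶜ) := by
  classical
  set Z : Matrix (Fin s) (Fin s) R := Matrix.of fun i j =>
    if j ∈ J then (if i ∈ N then A i j else 0) else (if i ∈ N then 0 else B i j) with hZ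
  by_cases h : J.card = N.card
  · have hc : Jᶜ.card = Nᶜ.card := by rw [Finset.card_compl, Finset.card_compl, h]
    obtain ⟨ρ, hρ, hρc⟩ := exists_perm_orderEmbOfFin N J h hc
    have memN : ∀ i ∈ N, ∃ a, N.orderEmbOfFin rfl a = i := by
      intro i hi
      have : i ∈ Set.range (N.orderEmbOfFin rfl) := by simpa using hi
      exact this
    have memNc : ∀ i ∉ N, ∃ a, Nᶜ.orderEmbOfFin rfl a = i := by
      intro i hi
      have : i ∈ Set.range (Nᶜ.orderEmbOfFin rfl) := by simpa using hi
      exact this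
    have hmem : ∀ i, ρ i ∈ J ↔ i ∈ N := by
      intro i
      by_cases hi : i ∈ N
      · obtain ⟨a, rfl⟩ := memN i hi
        simp only [hi, iff_true, hρ]
        exact J.orderEmbOfFin_mem h a
      · obtain ⟨a, rfl⟩ := memNc i hi
        simp only [hi, iff_false, hρc]
        exact Finset.mem_compl.1 (Jᶜ.orderEmbOfFin_mem hc a)
    have hsign := sign_eq_epsSign N J ρ hmem
      (by
        intro i hi j hj hij
        obtain ⟨a, rfl⟩ := memN i hi
        obtain ⟨b, rfl⟩ := memN j hj
        rw [hρ, hρ]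
        simpa using hij)
      (by
        intro i hi j hj hij
        obtain ⟨a, rfl⟩ := memNc i hi
        obtain ⟨b, rfl⟩ := memNc j hj
        rw [hρc, hρc]
        simpa using hij)
    have hdet := Matrix.det_permute' ρ Z
    rw [Matrix.twoBlockTriangular_det (Z.submatrix id ρ) (fun i => i ∈ N) (by
      intro i hi j hj
      simp [hZ, hmem, hi, hj])] at hdet
    let eN : Fin N.card ≃ {i // i ∈ N} := (N.orderIsoOfFin rfl).toEquiv
    let eNc : Fin Nᶜ.card ≃ {i // ¬ i ∈ N} := (Nᶜ.orderIsoOfFin rfl).toEquiv.trans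
      (Equiv.subtypeEquivRight fun i => Finset.mem_compl)
    have h1 : ((Z.submatrix id ρ).toSquareBlockProp fun i => i ∈ N).det = sortedMinor A N J := by
      rw [sortedMinor, dif_pos h, ← Matrix.det_submatrix_equiv_self eN]
      congr 1
      ext a b
      have ha : ((eN a : {i // i ∈ N}) : Fin s) = N.orderEmbOfFin rfl a := rfl
      have hb : ((eN b : {i // i ∈ N}) : Fin s) = N.orderEmbOfFin rfl b := rfl
      simp [hZ, Matrix.toSquareBlockProp, ha, hb, hρ]
    have h2 : ((Z.submatrix id ρ).toSquareBlockProp fun i => ¬ i ∈ N).det =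
        sortedMinor B Nᶜ Jᶜ := by
      rw [sortedMinor, dif_pos hc, ← Matrix.det_submatrix_equiv_self eNc]
      congr 1
      ext a b
      have ha : ((eNc a : {i // ¬ i ∈ N}) : Fin s) = Nᶜ.orderEmbOfFin rfl a := rfl
      have hb : ((eNc b : {i // ¬ i ∈ N}) : Fin s) = Nᶜ.orderEmbOfFin rfl b := rfl
      have ha' : Nᶜ.orderEmbOfFin rfl a ∉ N :=
        Finset.mem_compl.1 (Nᶜ.orderEmbOfFin_mem rfl a)
      have hb' : Jᶜ.orderEmbOfFin hc b ∉ J :=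
        Finset.mem_compl.1 (Jᶜ.orderEmbOfFin_mem hc b)
      simp [hZ, Matrix.toSquareBlockProp, ha, hb, hρc, ha', hb']
    have hprod : sortedMinor A N J * sortedMinor B Nᶜ Jᶜ = Equiv.Perm.sign ρ * Z.det := by
      rw [← h1, ← h2]
      convert hdet
    rw [hprod, ← hsign, zsmul_eq_mul, ← mul_assoc]
    rcases Int.units_eq_one_or (Equiv.Perm.sign ρ) with h | h <;> simp [h]
  · rw [sortedMinor, dif_neg h, zero_mul, smul_zero, Matrix.det_apply]
    refine Finset.sum_eq_zero fun σ _ => ?_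
    obtain ⟨i, hi⟩ : ∃ i, ¬ (i ∈ J ↔ σ i ∈ N) := by
      by_contra! hcon
      exact h (Finset.card_equiv σ hcon)
    rw [Finset.prod_eq_zero (Finset.mem_univ i), smul_zero]
    by_cases h1 : i ∈ J <;> by_cases h2 : σ i ∈ N <;> simp_all

/-- Laplace expansion of the determinant of a sum. -/
theorem det_add_eq_sum_sortedMinor {s : ℕ} {R : Type*} [CommRing R]
    (A B : Matrix (Fin s) (Fin s) R) :
    (A + B).det = ∑ N : Finset (Fin s), ∑ J : Finset (Fin s),
      epsSign s N J • (sortedMinor A N J * sortedMinor B Nᶜ Jᶜ) := by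
  classical
  have key : ∀ P Q : Matrix (Fin s) (Fin s) R, (P + Q).det =
      ∑ N : Finset (Fin s), (Matrix.of (N.piecewise P Q)).det := fun P Q =>
    (Matrix.detRowAlternating (n := Fin s) (R := R)).toMultilinearMap.map_add_univ P Q
  rw [key]
  refine Finset.sum_congr rfl fun N _ => ?_
  have h : (Matrix.of (N.piecewise A B)).transpose =
      (Matrix.of fun j i => if i ∈ N then A i j else 0) +
      (Matrix.of fun j i => if i ∈ N then 0 else B i j) := by
    ext j i
    by_cases hi : i ∈ N <;> simp [Finset.piecewise, hi]
  rw [← Matrix.det_transpose, h, key]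
  refine Finset.sum_congr rfl fun J _ => ?_
  rw [← det_two_blocks, ← Matrix.det_transpose]
  congr 1
  ext i j
  by_cases hj : j ∈ J <;> simp [Finset.piecewise, hj]

theorem sortedMinor_eq_det {s m : ℕ} {R : Type*} [CommRing R] (M : Matrix (Fin s) (Fin s) R)
    (I K : Finset (Fin s)) (hI : I.card = m) (hK : K.card = m) :
    sortedMinor M I K = (M.submatrix (I.orderEmbOfFin hI) (K.orderEmbOfFin hK)).det := by
  subst hI
  rw [sortedMinor, dif_pos hK]

theorem exists_perm_comp_orderEmbOfFin {s m : ℕ} (f : Fin m → Fin s)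
    (hf : Function.Injective f) :
    ∃ (I : Finset (Fin s)) (hI : I.card = m) (σ : Equiv.Perm (Fin m)),
      f = I.orderEmbOfFin hI ∘ σ := by
  have hI : (Finset.univ.image f).card = m := by
    rw [Finset.card_image_of_injective _ hf, Finset.card_univ, Fintype.card_fin]
  have hmem : ∀ a, f a ∈ Finset.univ.image f := fun a =>
    Finset.mem_image_of_mem f (Finset.mem_univ a)
  let σ : Fin m → Fin m := fun a => ((Finset.univ.image f).orderIsoOfFin hI).symm ⟨f a, hmem a⟩
  have hσ : Function.Injective σ := fun a b hab => by
    have := ((Finset.univ.image f).orderIsoOfFin hI).symm.injective hab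
    exact hf (congrArg Subtype.val this)
  refine ⟨_, hI, Equiv.ofBijective σ (Finite.injective_iff_bijective.1 hσ), ?_⟩
  ext a
  simp [σ, ← Finset.coe_orderIsoOfFin_apply]

theorem det_submatrix_eq_zero_of_sortedMinor {s m : ℕ} {R : Type*} [CommRing R]
    (M : Matrix (Fin s) (Fin s) R)
    (hM : ∀ I K : Finset (Fin s), I.card = m → K.card = m → sortedMinor M I K = 0)
    (f g : Fin m → Fin s) : (M.submatrix f g).det = 0 := by
  by_cases hf : Function.Injective f
  · by_cases hg : Function.Injective g
    · obtain ⟨I, hI, σ, rfl⟩ := exists_perm_comp_orderEmbOfFin f hf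
      obtain ⟨K, hK, τ, rfl⟩ := exists_perm_comp_orderEmbOfFin g hg
      have h := hM I K hI hK
      rw [sortedMinor_eq_det M I K hI hK] at h
      have e : M.submatrix (I.orderEmbOfFin hI ∘ σ) (K.orderEmbOfFin hK ∘ τ) =
          ((M.submatrix (I.orderEmbOfFin hI) (K.orderEmbOfFin hK)).submatrix σ id).submatrix
            id τ := rfl
      rw [e, Matrix.det_permute', Matrix.det_permute, h, mul_zero, mul_zero]
    · obtain ⟨a, b, hab, hne⟩ : ∃ a b, g a = g b ∧ a ≠ b := by
        simpa [Function.Injective] using hg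
      exact Matrix.det_zero_of_column_eq hne fun i => by simp [hab]
  · obtain ⟨a, b, hab, hne⟩ : ∃ a b, f a = f b ∧ a ≠ b := by
      simpa [Function.Injective] using hf
    exact Matrix.det_zero_of_row_eq hne (by ext j; simp [hab])

theorem det_submatrix_eq_zero_of_le {s m k : ℕ} {R : Type*} [CommRing R]
    (M : Matrix (Fin s) (Fin s) R)
    (hM : ∀ f g : Fin m → Fin s, (M.submatrix f g).det = 0) (hk : m ≤ k) :
    ∀ f g : Fin k → Fin s, (M.submatrix f g).det = 0 := by
  induction k, hk using Nat.le_induction with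
  | base => exact hM
  | succ k _ ih =>
    intro f g
    rw [Matrix.det_succ_row_zero]
    refine Finset.sum_eq_zero fun j _ => ?_
    rw [Matrix.submatrix_submatrix, ih, mul_zero]

theorem sortedMinor_eq_zero_of_lt {s n : ℕ} {R : Type*} [CommRing R]
    (M : Matrix (Fin s) (Fin s) R)
    (hM : ∀ f g : Fin (n + 1) → Fin s, (M.submatrix f g).det = 0)
    (I K : Finset (Fin s)) (hI : n < I.card) : sortedMinor M I K = 0 := by
  unfold sortedMinor
  split_ifs
  · exact det_submatrix_eq_zero_of_le M hM hI _ _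
  · rfl

/-- Multiplying rows and columns by scalars. -/
theorem det_submatrix_scale {s m : ℕ} {R : Type*} [CommRing R]
    (r c : Fin s → R) (M : Matrix (Fin s) (Fin s) R) (f g : Fin m → Fin s) :
    ((Matrix.of fun i j => r i * (c j * M i j)).submatrix f g).det =
      (∏ a, r (f a)) * ((∏ a, c (g a)) * (M.submatrix f g).det) := by
  rw [← Matrix.det_mul_row, ← Matrix.det_mul_column]
  rfl

theorem prod_orderEmbOfFin {s m : ℕ} {R : Type*} [CommRing R] (I : Finset (Fin s))
    (hI : I.card = m) (r : Fin s → R) : ∏ a, r (I.orderEmbOfFin hI a) = ∏ i ∈ I, r i := by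
  rw [← Finset.prod_coe_sort I r]
  exact Fintype.prod_equiv (I.orderIsoOfFin hI).toEquiv _ _ fun a => rfl

theorem sortedMinor_scale {s : ℕ} {R : Type*} [CommRing R]
    (r c : Fin s → R) (M : Matrix (Fin s) (Fin s) R) (I K : Finset (Fin s)) :
    sortedMinor (Matrix.of fun i j => r i * (c j * M i j)) I K =
      (∏ i ∈ I, r i) * ((∏ j ∈ K, c j) * sortedMinor M I K) := by
  by_cases h : K.card = I.card
  · rw [sortedMinor_eq_det _ I K rfl h, sortedMinor_eq_det M I K rfl h, det_submatrix_scale,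
      prod_orderEmbOfFin, prod_orderEmbOfFin]
  · simp [sortedMinor, h]

/-- The `n`-minors of `A` paired with the complementary minors of `Y`: the coefficient of `u ^ n`
in `det (u A + Y)`. -/
def mixedMinorSum {s : ℕ} {R : Type*} [CommRing R] (n : ℕ) (A Y : Matrix (Fin s) (Fin s) R) :
    R :=
  ∑ N ∈ Finset.powersetCard n (Finset.univ : Finset (Fin s)),
    ∑ J ∈ Finset.powersetCard n (Finset.univ : Finset (Fin s)),
      epsSign s N J • (sortedMinor A N J * sortedMinor Y Nᶜ Jᶜ)

/-- If the `(n+1)`-minors of `A(z)` vanish, the coefficient of `z ^ (s - n)` in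
`det (A(z) + z Y(z))` depends on `A(0)` and `Y(0)` only. -/
theorem coeff_det_add_X_mul {s n : ℕ} {R : Type*} [CommRing R] (hn : n ≤ s)
    (A Y : Matrix (Fin s) (Fin s) (PowerSeries R))
    (hA : ∀ f g : Fin (n + 1) → Fin s, (A.submatrix f g).det = 0) :
    PowerSeries.coeff (s - n)
        (A + Matrix.of fun i j => (PowerSeries.X : PowerSeries R) * Y i j).det =
      mixedMinorSum n (A.map PowerSeries.constantCoeff) (Y.map PowerSeries.constantCoeff) := by
  classical
  have hY : ∀ I K : Finset (Fin s),
      sortedMinor (Matrix.of fun i j => (PowerSeries.X : PowerSeries R) * Y i j) I K =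
        PowerSeries.X ^ I.card * sortedMinor Y I K := by
    intro I K
    have := sortedMinor_scale (fun _ => (PowerSeries.X : PowerSeries R)) (fun _ => 1) Y I K
    simpa using this
  rw [det_add_eq_sum_sortedMinor, map_sum, mixedMinorSum,
    ← Finset.sum_subset (Finset.subset_univ (Finset.powersetCard n Finset.univ))]
  · refine Finset.sum_congr rfl fun N hN => ?_
    have hNc : N.card = n := (Finset.mem_powersetCard.1 hN).2
    rw [map_sum, ← Finset.sum_subset (Finset.subset_univ (Finset.powersetCard n Finset.univ))]
    · refine Finset.sum_congr rfl fun J _ => ?_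
      rw [map_zsmul, hY, mul_left_comm, Finset.card_compl, Fintype.card_fin, hNc,
        ← map_sortedMinor, ← map_sortedMinor, ← map_mul]
      congr 1
      have := PowerSeries.coeff_X_pow_mul (sortedMinor A N J * sortedMinor Y Nᶜ Jᶜ) (s - n) 0
      simpa using this
    · intro J _ hJ
      have hJc : ¬ J.card = N.card := by
        rw [hNc]; simpa [Finset.mem_powersetCard] using hJ
      rw [sortedMinor, dif_neg hJc, zero_mul, smul_zero, map_zero]
  · intro N _ hN
    have hNc : N.card ≠ n := by simpa [Finset.mem_powersetCard] using hN
    rw [map_sum]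
    refine Finset.sum_eq_zero fun J _ => ?_
    have hNs : N.card ≤ s := by simpa using Finset.card_le_univ N
    rcases lt_or_gt_of_ne hNc with h | h
    · rw [map_zsmul, hY, mul_left_comm, Finset.card_compl, Fintype.card_fin,
        PowerSeries.coeff_X_pow_mul', if_neg (by omega), smul_zero]
    · rw [sortedMinor_eq_zero_of_lt A hA N J h, zero_mul, smul_zero, map_zero]

/-- Along a deformation `A(z)` with vanishing `(n+1)`-minors, `mixedMinorSum n A(0)` is invariant
under translation by the tangent vector. -/
theorem mixedMinorSum_sub_coeff_one {s n : ℕ} {R : Type*} [CommRing R] (hn : n ≤ s)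
    (A : Matrix (Fin s) (Fin s) (PowerSeries R)) (Y : Matrix (Fin s) (Fin s) R)
    (hA : ∀ f g : Fin (n + 1) → Fin s, (A.submatrix f g).det = 0) :
    mixedMinorSum n (A.map PowerSeries.constantCoeff) Y =
      mixedMinorSum n (A.map PowerSeries.constantCoeff) (Y - A.map (PowerSeries.coeff 1)) := by
  have h1 := coeff_det_add_X_mul hn A ((Y - A.map (PowerSeries.coeff 1)).map PowerSeries.C) hA
  have h2 := coeff_det_add_X_mul hn ((A.map PowerSeries.constantCoeff).map PowerSeries.C)
    (Matrix.of fun i j => PowerSeries.mk (fun k => PowerSeries.coeff (k + 1) (A i j)) +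
      PowerSeries.C ((Y - A.map (PowerSeries.coeff 1)) i j)) (by
        intro f g
        have := congrArg ((PowerSeries.C : R →+* PowerSeries R).comp PowerSeries.constantCoeff)
          (hA f g)
        rw [RingHom.map_det, map_zero] at this
        exact this)
  have e1 : ((Y - A.map (PowerSeries.coeff 1)).map (PowerSeries.C : R →+* PowerSeries R)).map
      PowerSeries.constantCoeff =
      Y - A.map (PowerSeries.coeff 1) := by
    ext i j; simp
  have e2 : ((A.map PowerSeries.constantCoeff).map (PowerSeries.C : R →+* PowerSeries R)).map
      PowerSeries.constantCoeff =
      A.map PowerSeries.constantCoeff := by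
    ext i j; simp
  have e3 : (Matrix.of fun i j => PowerSeries.mk (fun k => PowerSeries.coeff (k + 1) (A i j)) +
      PowerSeries.C ((Y - A.map (PowerSeries.coeff 1)) i j)).map PowerSeries.constantCoeff = Y := by
    ext i j
    simp [← PowerSeries.coeff_zero_eq_constantCoeff_apply, -PowerSeries.coeff_zero_eq_constantCoeff]
  rw [e1] at h1
  rw [e2, e3] at h2
  rw [← h1, ← h2]
  congr 2
  ext1 i j
  simp only [Matrix.add_apply, Matrix.of_apply, Matrix.map_apply]
  rw [mul_add, ← add_assoc]
  congr 1
  conv_rhs => rw [PowerSeries.eq_X_mul_shift_add_const (A i j)]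
  exact add_comm _ _

theorem sortedMinor_eq_zero_of_row {s : ℕ} {R : Type*} [CommRing R]
    (M : Matrix (Fin s) (Fin s) R) (N J : Finset (Fin s)) (i : Fin s) (hi : i ∈ N)
    (h : ∀ j, M i j = 0) : sortedMinor M N J = 0 := by
  unfold sortedMinor
  split_ifs
  · obtain ⟨a, rfl⟩ : i ∈ Set.range (N.orderEmbOfFin rfl) := by simpa using hi
    exact Matrix.det_eq_zero_of_row_eq_zero a fun j => h _
  · rfl

theorem sortedMinor_eq_zero_of_column {s : ℕ} {R : Type*} [CommRing R]
    (M : Matrix (Fin s) (Fin s) R) (N J : Finset (Fin s)) (j : Fin s) (hj : j ∈ J)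
    (h : ∀ i, M i j = 0) : sortedMinor M N J = 0 := by
  unfold sortedMinor
  split_ifs with hc
  · obtain ⟨a, rfl⟩ : j ∈ Set.range (J.orderEmbOfFin hc) := by simpa using hj
    exact Matrix.det_eq_zero_of_column_eq_zero a fun j => h _
  · rfl

/-- The matrix `M(0)` with the rows in `L` and the columns in `K` replaced by zero. -/
noncomputable def maskedConst {s : ℕ} {R : Type*} [CommRing R]
    (M : Matrix (Fin s) (Fin s) (PowerSeries R)) (L K : Finset (Fin s)) :
    Matrix (Fin s) (Fin s) (PowerSeries R) :=
  Matrix.of fun i j =>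
    if i ∈ L ∨ j ∈ K then 0 else PowerSeries.C (PowerSeries.constantCoeff (M i j))

/-- The matrix `(1 + z) D(z) M(t z) D'(z)`, where `D(z)` and `D'(z)` multiply the rows in `L` and
the columns in `K` by `z`. -/
noncomputable def maskDeformation {s : ℕ} {R : Type*} [CommRing R]
    (M : Matrix (Fin s) (Fin s) (PowerSeries R)) (L K : Finset (Fin s)) :
    Matrix (Fin s) (Fin s) (PowerSeries (PowerSeries R)) :=
  Matrix.of fun i j => ((1 + PowerSeries.X) * if i ∈ L then PowerSeries.X else 1) *
    ((if j ∈ K then PowerSeries.X else 1) *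
      PowerSeries.rescale (PowerSeries.X : PowerSeries R)
        (PowerSeries.map PowerSeries.C (M i j)))

theorem det_submatrix_maskDeformation {s m : ℕ} {R : Type*} [CommRing R]
    (M : Matrix (Fin s) (Fin s) (PowerSeries R)) (L K : Finset (Fin s))
    (hM : ∀ f g : Fin m → Fin s, (M.submatrix f g).det = 0)
    (f g : Fin m → Fin s) : ((maskDeformation M L K).submatrix f g).det = 0 := by
  have h := congrArg ((PowerSeries.rescale (PowerSeries.X : PowerSeries R)).comp
    (PowerSeries.map PowerSeries.C)) (hM f g)
  rw [RingHom.map_det, map_zero] at h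
  have h' : ((Matrix.of fun i j => PowerSeries.rescale (PowerSeries.X : PowerSeries R)
        (PowerSeries.map PowerSeries.C (M i j))).submatrix f g).det = 0 := h
  rw [maskDeformation, det_submatrix_scale
    (fun i => (1 + PowerSeries.X) * if i ∈ L then PowerSeries.X else 1)
    (fun j => if j ∈ K then PowerSeries.X else 1)
    (fun i j => PowerSeries.rescale (PowerSeries.X : PowerSeries R)
        (PowerSeries.map PowerSeries.C (M i j)))]
  exact (congrArg _ (congrArg _ h')).trans (by simp)

theorem constantCoeff_rescale_X_map_C {R : Type*} [CommRing R] (f : PowerSeries R) :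
    PowerSeries.constantCoeff (PowerSeries.rescale (PowerSeries.X : PowerSeries R)
      (PowerSeries.map PowerSeries.C f)) = PowerSeries.C (PowerSeries.constantCoeff f) := by
  rw [← PowerSeries.coeff_zero_eq_constantCoeff_apply, PowerSeries.coeff_rescale]
  simp

theorem maskDeformation_map_constantCoeff {s : ℕ} {R : Type*} [CommRing R]
    (M : Matrix (Fin s) (Fin s) (PowerSeries R)) (L K : Finset (Fin s)) :
    (maskDeformation M L K).map PowerSeries.constantCoeff = maskedConst M L K := by
  ext1 i j
  by_cases hi : i ∈ L <;> by_cases hj : j ∈ K <;>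
    simp [maskDeformation, maskedConst, hi, hj, constantCoeff_rescale_X_map_C]

theorem dvd_sub_maskDeformation_coeff_one {s : ℕ} {R : Type*} [CommRing R]
    (M : Matrix (Fin s) (Fin s) (PowerSeries R)) (L K : Finset (Fin s)) (i j : Fin s) :
    (if i ∈ L then 1 else PowerSeries.X) * (if j ∈ K then 1 else PowerSeries.X) ∣
      (M - (maskDeformation M L K).map (PowerSeries.coeff 1)) i j := by
  have h0 : ∀ f : PowerSeries (PowerSeries R), PowerSeries.coeff 1 (PowerSeries.X * f) =
      PowerSeries.constantCoeff f := by
    intro f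
    simp
  by_cases hi : i ∈ L <;> by_cases hj : j ∈ K
  · simp [hi, hj]
  · have : (maskDeformation M L K).map (PowerSeries.coeff 1) i j =
        PowerSeries.C (PowerSeries.constantCoeff (M i j)) := by
      simp [maskDeformation, hi, hj, mul_assoc, add_mul, h0, constantCoeff_rescale_X_map_C]
    rw [Matrix.sub_apply, this]
    simp [hi, hj, PowerSeries.X_dvd_iff]
  · have : (maskDeformation M L K).map (PowerSeries.coeff 1) i j =
        PowerSeries.C (PowerSeries.constantCoeff (M i j)) := by
      simp [maskDeformation, hi, hj, mul_assoc, add_mul, h0, constantCoeff_rescale_X_map_C]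
    rw [Matrix.sub_apply, this]
    simp [hi, hj, PowerSeries.X_dvd_iff]
  · have : (maskDeformation M L K).map (PowerSeries.coeff 1) i j =
        PowerSeries.X * PowerSeries.C (PowerSeries.coeff 1 (M i j)) +
        PowerSeries.C (PowerSeries.constantCoeff (M i j)) := by
      simp [maskDeformation, hi, hj, add_mul, h0, constantCoeff_rescale_X_map_C]
    rw [Matrix.sub_apply, this]
    simp only [hi, hj, if_false, ← pow_two]
    rw [PowerSeries.X_pow_dvd_iff]
    intro m hm
    interval_cases m
    · simp
    · have h1 : PowerSeries.coeff 1 (PowerSeries.X * PowerSeries.C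
          (PowerSeries.coeff 1 (M i j))) = PowerSeries.coeff 1 (M i j) := by
        simp
      simp [h1]

theorem X_pow_dvd_prod_compl {s n : ℕ} {R : Type*} [CommRing R] (L N : Finset (Fin s))
    (hN : N.card = n) :
    (PowerSeries.X : PowerSeries R) ^ (s - n - L.card) ∣
      ∏ i ∈ Nᶜ, if i ∈ L then 1 else PowerSeries.X := by
  classical
  rw [Finset.prod_ite, Finset.prod_const_one, one_mul, Finset.prod_const]
  refine pow_dvd_pow _ ?_
  have h1 : Nᶜ.filter (fun i => i ∉ L) = Nᶜ \ L := by ext; simp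
  rw [h1]
  have h2 := Finset.le_card_sdiff L Nᶜ
  rw [Finset.card_compl, Fintype.card_fin, hN] at h2
  exact h2

theorem X_pow_dvd_mixedMinorSum {s n : ℕ} {R : Type*} [CommRing R] (hn : n ≤ s)
    (M : Matrix (Fin s) (Fin s) (PowerSeries R)) (L K : Finset (Fin s))
    (hM : ∀ f g : Fin (n + 1) → Fin s, (M.submatrix f g).det = 0) :
    (PowerSeries.X : PowerSeries R) ^ ((s - n - L.card) + (s - n - K.card)) ∣
      mixedMinorSum n (maskedConst M L K) M := by
  have h := mixedMinorSum_sub_coeff_one hn (maskDeformation M L K) M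
    (det_submatrix_maskDeformation M L K hM)
  rw [maskDeformation_map_constantCoeff] at h
  rw [h]
  choose q hq using dvd_sub_maskDeformation_coeff_one M L K
  have hY : M - (maskDeformation M L K).map (PowerSeries.coeff 1) =
      Matrix.of fun i j => (if i ∈ L then 1 else PowerSeries.X) *
        ((if j ∈ K then 1 else PowerSeries.X) * Matrix.of q i j) := by
    ext1 i j
    rw [hq, mul_assoc]
    rfl
  rw [hY]
  refine Finset.dvd_sum fun N hN => Finset.dvd_sum fun J hJ => ?_
  rw [sortedMinor_scale (fun i => if i ∈ L then 1 else PowerSeries.X)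
    (fun j => if j ∈ K then 1 else PowerSeries.X), zsmul_eq_mul, pow_add, ← mul_assoc (∏ i ∈ Nᶜ, _)]
  exact Dvd.dvd.mul_left (Dvd.dvd.mul_left (Dvd.dvd.mul_right (mul_dvd_mul
    (X_pow_dvd_prod_compl L N (Finset.mem_powersetCard.1 hN).2)
    (X_pow_dvd_prod_compl K J (Finset.mem_powersetCard.1 hJ).2)) _) _) _

/-- Masking restricts the minors of `M(0)` to rows outside `L` and columns outside `K`. -/
theorem mixedMinorSum_maskedConst {s n : ℕ} {R : Type*} [CommRing R]
    (M : Matrix (Fin s) (Fin s) (PowerSeries R)) (L K : Finset (Fin s)) :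
    mixedMinorSum n (maskedConst M L K) M =
      ∑ N ∈ Finset.powersetCard n Lᶜ, ∑ J ∈ Finset.powersetCard n Kᶜ, epsSign s N J •
        (PowerSeries.C (sortedMinor (M.map PowerSeries.constantCoeff) N J) *
          sortedMinor M Nᶜ Jᶜ) := by
  rw [mixedMinorSum,
    ← Finset.sum_subset (Finset.powersetCard_mono (Finset.subset_univ Lᶜ))]
  · refine Finset.sum_congr rfl fun N hN => ?_
    rw [← Finset.sum_subset (Finset.powersetCard_mono (Finset.subset_univ Kᶜ))]
    · refine Finset.sum_congr rfl fun J hJ => ?_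
      have hN' := (Finset.mem_powersetCard.1 hN).1
      have hJ' := (Finset.mem_powersetCard.1 hJ).1
      congr 2
      rw [map_sortedMinor]
      unfold sortedMinor
      split_ifs with hc
      · congr 1
        ext1 a b
        have ha := Finset.mem_compl.1 (hN' (N.orderEmbOfFin_mem rfl a))
        have hb := Finset.mem_compl.1 (hJ' (J.orderEmbOfFin_mem hc b))
        simp [maskedConst, ha, hb]
      · rfl
    · intro J hJ hJ'
      obtain ⟨j, hj, hjK⟩ : ∃ j ∈ J, j ∈ K := by
        by_contra! hcon
        exact hJ' (Finset.mem_powersetCard.2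
          ⟨fun j hj => Finset.mem_compl.2 (hcon j hj), (Finset.mem_powersetCard.1 hJ).2⟩)
      rw [sortedMinor_eq_zero_of_column _ N J j hj (by simp [maskedConst, hjK]), zero_mul,
        smul_zero]
  · intro N hN hN'
    obtain ⟨i, hi, hiL⟩ : ∃ i ∈ N, i ∈ L := by
      by_contra! hcon
      exact hN' (Finset.mem_powersetCard.2
        ⟨fun i hi => Finset.mem_compl.2 (hcon i hi), (Finset.mem_powersetCard.1 hN).2⟩)
    refine Finset.sum_eq_zero fun J _ => ?_
    rw [sortedMinor_eq_zero_of_row _ N J i hi (by simp [maskedConst, hiL]), zero_mul, smul_zero]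

/-- The Taylor homomorphism `x_{ij}^{(k)} ↦ Σ_l binom(k + l, k) x_{ij}^{(k+l)} t^l`. -/
noncomputable def taylorHom (s : ℕ) : PolyS s →+* PowerSeries (PolyS s) :=
  (aeval fun v : Fin s × Fin s × ℕ => PowerSeries.mk fun l =>
    ((v.2.2 + l).choose v.2.2 : PolyS s) * X (v.1, v.2.1, v.2.2 + l) :
      PolyS s →ₐ[ℤ] PowerSeries (PolyS s)).toRingHom

theorem taylorHom_X (s : ℕ) (v : Fin s × Fin s × ℕ) :
    taylorHom s (X v) = PowerSeries.mk fun l =>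
      ((v.2.2 + l).choose v.2.2 : PolyS s) * X (v.1, v.2.1, v.2.2 + l) :=
  aeval_X _ v

theorem constantCoeff_taylorHom (s : ℕ) (p : PolyS s) :
    PowerSeries.constantCoeff (taylorHom s p) = p := by
  suffices h : (PowerSeries.constantCoeff.comp (taylorHom s)) = RingHom.id _ from
    RingHom.congr_fun h p
  refine MvPolynomial.ringHom_ext' (RingHom.ext_int _ _) fun v => ?_
  rw [RingHom.comp_apply, taylorHom_X, ← PowerSeries.coeff_zero_eq_constantCoeff_apply,
    PowerSeries.coeff_mk]
  simp

theorem taylorHom_dFull (s : ℕ) (p : PolyS s) :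
    taylorHom s (dFull s p) = PowerSeries.derivative (PolyS s) (taylorHom s p) := by
  induction p using MvPolynomial.induction_on with
  | C a => simp
  | add p q hp hq => simp only [map_add, hp, hq]
  | mul_X p v hp =>
    have hv : taylorHom s (dFull s (X v)) =
        PowerSeries.derivative (PolyS s) (taylorHom s (X v)) := by
      rw [dFull, mkDerivation_X, taylorHom_X, map_zsmul, taylorHom_X]
      ext1 l
      rw [PowerSeries.coeff_derivative, PowerSeries.coeff_mk, map_zsmul, PowerSeries.coeff_mk]
      have h : (v.2.2 + 1) * (v.2.2 + 1 + l).choose (v.2.2 + 1) =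
          (v.2.2 + (l + 1)).choose v.2.2 * (l + 1) := by
        have := Nat.choose_succ_right_eq (v.2.2 + (l + 1)) v.2.2
        rw [show v.2.2 + 1 + l = v.2.2 + (l + 1) by ring, mul_comm, this,
          Nat.add_sub_cancel_left]
      have h' := congrArg (Nat.cast : ℕ → PolyS s) h
      push_cast at h'
      rw [zsmul_eq_mul, show v.2.2 + (l + 1) = v.2.2 + 1 + l by ring] at *
      push_cast
      linear_combination (X (v.1, v.2.1, v.2.2 + 1 + l) : PolyS s) * h'
    simp only [Derivation.leibniz, map_add, map_mul, smul_eq_mul, hp, hv]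

theorem factorial_smul_coeff_taylorHom (s l : ℕ) (p : PolyS s) :
    (l.factorial : ℤ) • PowerSeries.coeff l (taylorHom s p) = (⇑(dFull s))^[l] p := by
  have h : ∀ m, taylorHom s ((⇑(dFull s))^[m] p) =
      (PowerSeries.derivative (PolyS s))^[m] (taylorHom s p) := by
    intro m
    induction m with
    | zero => rfl
    | succ m ih => rw [Function.iterate_succ_apply', Function.iterate_succ_apply',
        taylorHom_dFull, ih]
  rw [← constantCoeff_taylorHom s ((⇑(dFull s))^[l] p), h,
    PowerSeries.constantCoeff_iterate_derivative, zsmul_eq_mul]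
  push_cast
  rfl

theorem coeff_taylorHom_minorA_mem (s m l : ℕ) (I K : Finset (Fin s)) (hI : I.card = m)
    (hK : K.card = m) :
    PowerSeries.coeff l (taylorHom s (minorA s I K)) ∈ minorIdealS s m :=
  Ideal.subset_span ⟨l, I, K, hI, hK, factorial_smul_coeff_taylorHom s l _⟩

/-- Lemma 6.3: for `L, K ⊆ S` with `|L|, |K| ≤ s − n` and
`0 ≤ l ≤ 2(s−n) − |L| − |K| − 1`,
`Σ_{N ⊆ S∖L, |N|=n} Σ_{J ⊆ S∖K, |J|=n} ε(N,J) 𝒜(N,J) ∂̄^l 𝒜(S∖N, S∖J) ∈ 𝔯[n+1]`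
(stated in `l!`-cleared form). -/
theorem minor_sum_in_minorIdeal (s n l : ℕ) (L K : Finset (Fin s))
    (hL : L.card + n ≤ s) (hK : K.card + n ≤ s)
    (hl : l + L.card + K.card + 1 + 2 * n ≤ 2 * s)
    (g : PolyS s)
    (hg : (l.factorial : ℤ) • g =
      ∑ N ∈ Finset.powersetCard n Lᶜ, ∑ J ∈ Finset.powersetCard n Kᶜ,
        epsSign s N J • (minorA s N J * (⇑(dFull s))^[l] (minorA s Nᶜ Jᶜ))) :
    g ∈ minorIdealS s (n + 1) := by
  set F : PowerSeries (PolyS s) :=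
    ∑ N ∈ Finset.powersetCard n Lᶜ, ∑ J ∈ Finset.powersetCard n Kᶜ,
      epsSign s N J • (PowerSeries.C (minorA s N J) * taylorHom s (minorA s Nᶜ Jᶜ)) with hF
  have hgF : g = PowerSeries.coeff l F := by
    have h0 : (l.factorial : ℤ) ≠ 0 := by exact_mod_cast l.factorial_ne_zero
    refine smul_right_injective (PolyS s) h0 ?_
    simp only [hg, hF, map_sum, Finset.smul_sum, map_zsmul, PowerSeries.coeff_C_mul,
      ← factorial_smul_coeff_taylorHom]
    refine Finset.sum_congr rfl fun N _ => Finset.sum_congr rfl fun J _ => ?_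
    rw [smul_comm, mul_smul_comm]
  let π := Ideal.Quotient.mk (minorIdealS s (n + 1))
  let A : Matrix (Fin s) (Fin s) (PolyS s) := Matrix.of fun i j => X (i, j, 0)
  let τ := (PowerSeries.map π).comp (taylorHom s)
  have hA : ∀ I J, sortedMinor (A.map τ) I J = PowerSeries.map π (taylorHom s (minorA s I J)) :=
    fun I J => (map_sortedMinor τ A I J).symm
  have hM : ∀ f h : Fin (n + 1) → Fin s, ((A.map τ).submatrix f h).det = 0 := by
    refine det_submatrix_eq_zero_of_sortedMinor _ fun I J hI hJ => ?_
    rw [hA]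
    ext1 k
    rw [PowerSeries.coeff_map, map_zero]
    exact Ideal.Quotient.eq_zero_iff_mem.2 (coeff_taylorHom_minorA_mem s (n + 1) k I J hI hJ)
  have hA0 : (A.map τ).map PowerSeries.constantCoeff = A.map π := by
    ext1 i j
    simp only [Matrix.map_apply, τ, RingHom.comp_apply]
    rw [← PowerSeries.coeff_zero_eq_constantCoeff_apply, PowerSeries.coeff_map,
      PowerSeries.coeff_zero_eq_constantCoeff_apply, constantCoeff_taylorHom]
  have hπF : PowerSeries.map π F = mixedMinorSum n (maskedConst (A.map τ) L K) (A.map τ) := by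
    rw [mixedMinorSum_maskedConst, hA0, hF]
    rw [map_sum]
    refine Finset.sum_congr rfl fun N _ => ?_
    rw [map_sum]
    refine Finset.sum_congr rfl fun J _ => ?_
    rw [hA, map_zsmul, map_mul, PowerSeries.map_C, minorA_eq_sortedMinor, map_sortedMinor]
  have hdvd := X_pow_dvd_mixedMinorSum (by omega) (A.map τ) L K hM
  rw [← hπF, PowerSeries.X_pow_dvd_iff] at hdvd
  rw [← Ideal.Quotient.eq_zero_iff_mem, hgF]
  exact (PowerSeries.coeff_map π l F).symm.trans (hdvd l (by omega))
end

section
/- (Lemma 6.4) Define ℱ^k_l(L_0, L_1, K_0, K_1, n) = Σ_{N: |N|=n, L_0 ⊂ N ⊂ S∖L_1} Σ_{J: |J|=n, K_0 ⊂ J ⊂ S∖K_1} ε(N,J) ∂̄^l 𝒜(N,J) ∂̄^{k−l} 𝒜(S∖N, S∖J). If L_0 ∩ L_1 = ∅ = K_0 ∩ K_1, |L_0|+|L_1| ≤ s−n, |K_0|+|K_1| ≤ s−n, and l ≤ 2(s−n) − |L_0| − |L_1| − |K_0| − |K_1| − 1, then ℱ^l_0(L_0, L_1, K_0, K_1, n)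 ∈ 𝔯[n+1]. -/
open MvPolynomial

/-- The factorial-cleared version of `ℱ^k_l`:
`Fraw l l' = Σ_{N,J} ε(N,J) (∂^l 𝒜(N,J)) (∂^{l'} 𝒜(S∖N, S∖J))`,
summed over `|N| = n` with `L₀ ⊆ N ⊆ S∖L₁` and `|J| = n` with `K₀ ⊆ J ⊆ S∖K₁`;
thus `l! · l'! · ℱ^{l+l'}_l = Fraw l l'`. -/
noncomputable def Fraw (s : ℕ) (L0 L1 K0 K1 : Finset (Fin s)) (n l l' : ℕ) :
    PolyS s :=
  ∑ N ∈ (Finset.powersetCard n L1ᶜ).filter (fun N => L0 ⊆ N),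
    ∑ J ∈ (Finset.powersetCard n K1ᶜ).filter (fun J => K0 ⊆ J),
      epsSign s N J •
        ((⇑(dFull s))^[l] (minorA s N J) * (⇑(dFull s))^[l'] (minorA s Nᶜ Jᶜ))

theorem finSumEquivOfFinset_eq_trans_swap {s n m : ℕ} {N : Finset (Fin s)} (hN : N.card = n)
    (hN' : Nᶜ.card = m) {k l : Fin s} (hkl : (l : ℕ) = k + 1) (hk : k ∉ N) (hl : l ∈ N)
    {N' : Finset (Fin s)} (hmap : ∀ x, x ∈ N' ↔ Equiv.swap k l x ∈ N)
    (hN₂ : N'.card = n) (hN₂' : N'ᶜ.card = m) :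
    finSumEquivOfFinset hN₂ hN₂' = (finSumEquivOfFinset hN hN').trans (Equiv.swap k l) := by
  have key : ∀ x y : Fin s, x < y → (x ∈ N ↔ y ∈ N) →
      Equiv.swap k l x < Equiv.swap k l y := by
    intro x y hxy h
    have hne : ¬ (x = k ∧ y = l) := by
      rintro ⟨rfl, rfl⟩
      exact hk (h.2 hl)
    simp only [Equiv.swap_apply_def]
    simp only [Fin.ext_iff, Fin.lt_def] at *
    split_ifs <;> omega
  ext x
  rcases x with x | x
  · simp only [finSumEquivOfFinset_inl, Equiv.trans_apply]
    have := Finset.orderEmbOfFin_unique (s := N') hN₂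
      (f := fun x => Equiv.swap k l (N.orderEmbOfFin hN x))
      (fun x => by simp [hmap]) (fun x y hxy => key _ _ (by simpa using hxy) (by simp))
    rw [← this]
  · simp only [finSumEquivOfFinset_inr, Equiv.trans_apply]
    have hc : ∀ x, Nᶜ.orderEmbOfFin hN' x ∉ N := fun x =>
      Finset.mem_compl.1 (Finset.orderEmbOfFin_mem _ _ _)
    have := Finset.orderEmbOfFin_unique (s := N'ᶜ) hN₂'
      (f := fun x => Equiv.swap k l (Nᶜ.orderEmbOfFin hN' x))
      (fun x => by simp [hmap, hc]) (fun x y hxy => key _ _ (by simpa using hxy) (by simp [hc]))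
    rw [← this]

theorem Finset.eq_filter_lt_of_isLowerSet {s n : ℕ} {N : Finset (Fin s)} (hN : N.card = n)
    (h : ∀ k l : Fin s, (l : ℕ) = k + 1 → l ∈ N → k ∈ N) :
    N = Finset.univ.filter fun x : Fin s => (x : ℕ) < n := by
  have hlow : ∀ d : ℕ, ∀ k l : Fin s, (l : ℕ) = k + d → l ∈ N → k ∈ N := by
    intro d
    induction d with
    | zero =>
      intro k l hkl hl
      rwa [show k = l from Fin.ext (by omega)]
    | succ d ih =>
      intro k l hkl hl
      exact ih k ⟨k + d, by omega⟩ rfl (h _ l (by simp; omega) hl)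
  refine Finset.eq_of_subset_of_card_le ?_ ?_
  · intro x hx
    simp only [Finset.mem_filter, Finset.mem_univ, true_and]
    have hsub : Finset.Iic x ⊆ N := fun y hy => by
      have hy := Finset.mem_Iic.1 hy
      exact hlow (x - y) y x (by have := Fin.le_def.1 hy; omega) hx
    have := Finset.card_le_card hsub
    rw [Fin.card_Iic] at this
    omega
  · rw [hN]
    have : ((Finset.univ.filter fun x : Fin s => (x : ℕ) < n).map Fin.valEmbedding) ⊆
        Finset.range n := by
      intro y
      simp only [Finset.mem_map, Finset.mem_filter, Finset.mem_univ, true_and,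
        Fin.valEmbedding_apply, Finset.mem_range]
      rintro ⟨x, hx, rfl⟩
      exact hx
    simpa using Finset.card_le_card this

/-- `ε(N,J)` is the sign of the permutation carrying `N` to `J` and `Nᶜ` to `Jᶜ` increasingly. -/
theorem sign_finSumEquivOfFinset {s n m : ℕ} {N J : Finset (Fin s)} (hN : N.card = n)
    (hN' : Nᶜ.card = m) (hJ : J.card = n) (hJ' : Jᶜ.card = m) :
    ((Equiv.Perm.sign ((finSumEquivOfFinset hN hN').symm.trans (finSumEquivOfFinset hJ hJ')) :
      ℤˣ) : ℤ) = epsSign s N J := by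
  have initial : ∀ d : ℕ, ∀ N : Finset (Fin s), ∑ i ∈ N, ((i : ℕ) + 1) = d →
      ∀ (hN : N.card = n) (hN' : Nᶜ.card = m) (N₀ : Finset (Fin s)) (hN₀ : N₀.card = n)
        (hN₀' : N₀ᶜ.card = m), (N₀ = Finset.univ.filter fun x : Fin s => (x : ℕ) < n) →
      ((Equiv.Perm.sign
        ((finSumEquivOfFinset hN hN').symm.trans (finSumEquivOfFinset hN₀ hN₀')) : ℤˣ) : ℤ)
        = epsSign s N N₀ := by
    intro d
    induction d with
    | zero =>
      intro N hd hN hN' N₀ hN₀ hN₀' h₀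
      have : N = N₀ := by
        rw [h₀]
        refine Finset.eq_filter_lt_of_isLowerSet hN fun k l _ hl => ?_
        simp only [Finset.sum_eq_zero_iff] at hd
        exact absurd (hd l hl) (by omega)
      subst this
      simp [epsSign]
    | succ d ih =>
      intro N hd hN hN' N₀ hN₀ hN₀' h₀
      by_cases h : ∀ k l : Fin s, (l : ℕ) = k + 1 → l ∈ N → k ∈ N
      · have : N = N₀ := by
          rw [h₀]
          exact Finset.eq_filter_lt_of_isLowerSet hN h
        subst this
        simp [epsSign]
      · push Not at h
        obtain ⟨k, l, hkl, hl, hk⟩ := h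
        have hne : k ≠ l := fun h => by simp [h] at hkl
        set w := Equiv.swap k l with hw
        set N' := N.map w.toEmbedding with hN'def
        have hmap : ∀ x, x ∈ N' ↔ w x ∈ N := by
          intro x
          rw [hN'def, Finset.mem_map_equiv, hw, Equiv.symm_swap]
        have hN₂ : N'.card = n := by simp [hN'def, hN]
        have hN₂' : N'ᶜ.card = m := by
          rw [Finset.card_compl] at hN' ⊢
          rw [hN₂, ← hN', hN]
        have hsum : ∑ i ∈ N', ((i : ℕ) + 1) = d := by
          rw [hN'def, Finset.sum_map, ← Finset.add_sum_erase _ _ hl]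
          rw [← Finset.add_sum_erase _ _ hl] at hd
          have : ∑ x ∈ N.erase l, ((w.toEmbedding x : ℕ) + 1) =
              ∑ x ∈ N.erase l, ((x : ℕ) + 1) := by
            refine Finset.sum_congr rfl fun x hx => ?_
            have hxl := Finset.ne_of_mem_erase hx
            have hxk : x ≠ k := fun h => hk (h ▸ Finset.mem_of_mem_erase hx)
            simp [hw, Equiv.swap_apply_of_ne_of_ne hxk hxl]
          rw [this]
          simp [hw]
          omega
        have hIH := ih N' hsum hN₂ hN₂' N₀ hN₀ hN₀' h₀
        have he := finSumEquivOfFinset_eq_trans_swap hN hN' hkl hk hl hmap hN₂ hN₂'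
        have hcomp : (finSumEquivOfFinset hN hN').symm.trans (finSumEquivOfFinset hN₀ hN₀') =
            w.trans ((finSumEquivOfFinset hN₂ hN₂').symm.trans
              (finSumEquivOfFinset hN₀ hN₀')) := by
          rw [he]
          ext x
          simp [hw]
        rw [hcomp, Equiv.Perm.sign_trans, Units.val_mul, hIH, hw, Equiv.Perm.sign_swap hne]
        simp only [epsSign, hsum, hd]
        push_cast
        ring
  obtain ⟨N₀, h₀⟩ : ∃ N₀ : Finset (Fin s),
      N₀ = Finset.univ.filter fun x : Fin s => (x : ℕ) < n := ⟨_, rfl⟩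
  have hns : n ≤ s := by
    rw [← hN]
    simpa using Finset.card_le_univ N
  have hN₀ : N₀.card = n := by
    rw [h₀, Fin.card_filter_val_lt, min_eq_right hns]
  have hN₀' : N₀ᶜ.card = m := by
    rw [Finset.card_compl] at hN' ⊢
    rw [hN₀, ← hN', hN]
  have h1 := initial _ N rfl hN hN' N₀ hN₀ hN₀' h₀
  have h2 := initial _ J rfl hJ hJ' N₀ hN₀ hN₀' h₀
  have hcomp : (finSumEquivOfFinset hN hN').symm.trans (finSumEquivOfFinset hJ hJ') =
      ((finSumEquivOfFinset hN hN').symm.trans (finSumEquivOfFinset hN₀ hN₀')).trans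
        ((finSumEquivOfFinset hJ hJ').symm.trans (finSumEquivOfFinset hN₀ hN₀')).symm := by
    ext x
    simp
  rw [hcomp, Equiv.Perm.sign_trans, Equiv.Perm.sign_symm, Units.val_mul, h1, h2]
  simp only [epsSign]
  generalize ∑ i ∈ N, ((i : ℕ) + 1) = x
  generalize ∑ i ∈ J, ((i : ℕ) + 1) = y
  generalize ∑ i ∈ N₀, ((i : ℕ) + 1) = z
  rw [← pow_add, show y + z + (x + z) = x + y + (z + z) by ring, pow_add,
    (Even.add_self z).neg_one_pow, mul_one]

/-- The minor of `A` on the rows `I` and columns `K` in increasing order, and `0` if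
`|I| ≠ |K|`. -/
noncomputable def Matrix.minorOn {s : ℕ} {R : Type*} [CommRing R] (A : Matrix (Fin s) (Fin s) R)
    (I K : Finset (Fin s)) : R :=
  if h : K.card = I.card then (A.submatrix (I.orderEmbOfFin rfl) (K.orderEmbOfFin h)).det else 0

theorem Matrix.minorOn_eq {s n : ℕ} {R : Type*} [CommRing R] (A : Matrix (Fin s) (Fin s) R)
    {I K : Finset (Fin s)} (hI : I.card = n) (hK : K.card = n) :
    A.minorOn I K = (A.submatrix (I.orderEmbOfFin hI) (K.orderEmbOfFin hK)).det := by
  subst hI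
  simp [Matrix.minorOn, hK]

theorem Matrix.map_minorOn {s : ℕ} {R T : Type*} [CommRing R] [CommRing T] (f : R →+* T)
    (A : Matrix (Fin s) (Fin s) R) (I K : Finset (Fin s)) :
    f (A.minorOn I K) = (A.map f).minorOn I K := by
  unfold Matrix.minorOn
  split_ifs with h
  · rw [RingHom.map_det]
    rfl
  · simp

theorem Matrix.det_mask_eq {s n : ℕ} {R : Type*} [CommRing R] (A B : Matrix (Fin s) (Fin s) R)
    {N J : Finset (Fin s)} (hN : N.card = n) (hJ : J.card = n) :
    (Matrix.of fun i j => if i ∈ N then (if j ∈ J then A i j else 0)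
      else (if j ∈ J then 0 else B i j)).det =
    epsSign s N J • (A.minorOn N J * B.minorOn Nᶜ Jᶜ) := by
  set M : Matrix (Fin s) (Fin s) R := Matrix.of fun i j =>
    if i ∈ N then (if j ∈ J then A i j else 0) else (if j ∈ J then 0 else B i j) with hM
  obtain ⟨m, hN'⟩ : ∃ m, Nᶜ.card = m := ⟨_, rfl⟩
  have hJ' : Jᶜ.card = m := by
    rw [Finset.card_compl] at hN' ⊢
    rw [hJ, ← hN', hN]
  rw [A.minorOn_eq hN hJ, B.minorOn_eq hN' hJ', ← sign_finSumEquivOfFinset hN hN' hJ hJ']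
  set e := finSumEquivOfFinset hN hN' with he
  set f := finSumEquivOfFinset hJ hJ' with hf
  have hc : ∀ {I : Finset (Fin s)} (h : Iᶜ.card = m) x, Iᶜ.orderEmbOfFin h x ∉ I :=
    fun h x => Finset.mem_compl.1 (Finset.orderEmbOfFin_mem _ _ _)
  have h1 : (M.submatrix e f).det = (A.submatrix (N.orderEmbOfFin hN) (J.orderEmbOfFin hJ)).det *
      (B.submatrix (Nᶜ.orderEmbOfFin hN') (Jᶜ.orderEmbOfFin hJ')).det := by
    rw [← Matrix.det_fromBlocks_zero₂₁ _ 0]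
    congr 1
    ext i j
    rcases i with i | i <;> rcases j with j | j <;> simp [hM, he, hf, hc]
  have h2 : M.submatrix e f = (M.submatrix id (e.symm.trans f)).submatrix e e := by
    ext i j
    simp
  rw [← h1, h2, Matrix.det_submatrix_equiv_self, Matrix.det_permute', zsmul_eq_mul, ← mul_assoc,
    ← Int.cast_mul, ← Units.val_mul, Int.units_mul_self]
  simp

/-- Laplace expansion along the rows in `N`. -/
theorem Matrix.det_piecewise {s n : ℕ} {R : Type*} [CommRing R] (A B : Matrix (Fin s) (Fin s) R)
    {N : Finset (Fin s)} (hN : N.card = n) :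
    (Matrix.of (N.piecewise A B)).det =
      ∑ J ∈ Finset.powersetCard n Finset.univ,
        epsSign s N J • (A.minorOn N J * B.minorOn Nᶜ Jᶜ) := by
  rw [← Finset.sum_congr rfl fun J hJ =>
    Matrix.det_mask_eq A B hN (Finset.mem_powersetCard.1 hJ).2]
  simp only [Matrix.det_apply]
  rw [Finset.sum_comm]
  refine Finset.sum_congr rfl fun σ _ => ?_
  rw [← Finset.smul_sum]
  congr 1
  have hmem : N.map σ.symm.toEmbedding ∈ Finset.powersetCard n Finset.univ := by
    simp [Finset.mem_powersetCard, hN]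
  rw [Finset.sum_eq_single_of_mem _ hmem]
  · refine Finset.prod_congr rfl fun i _ => ?_
    by_cases h : σ i ∈ N <;> simp [h, Finset.mem_map_equiv, Finset.piecewise]
  · intro J hJ hne
    by_contra hprod
    apply hne
    symm
    refine Finset.eq_of_subset_of_card_le (fun i hi => ?_) ?_
    · rw [Finset.mem_map_equiv, Equiv.symm_symm] at hi
      by_contra h
      exact hprod (Finset.prod_eq_zero (Finset.mem_univ i) (by simp [hi, h]))
    · simp [hN, (Finset.mem_powersetCard.1 hJ).2]

/-- All `(n+1)`-minors of `A` vanish. -/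
def Matrix.MinorsVanish {ι κ R : Type*} [CommRing R] (n : ℕ) (A : Matrix ι κ R) : Prop :=
  ∀ (f : Fin (n + 1) → ι) (g : Fin (n + 1) → κ), (A.submatrix f g).det = 0

namespace Matrix.MinorsVanish

variable {ι κ R : Type*} [CommRing R] {n : ℕ}

theorem submatrix {A : Matrix ι κ R} (hA : A.MinorsVanish n) {ι' κ' : Type*} (f : ι' → ι)
    (g : κ' → κ) : (A.submatrix f g).MinorsVanish n := fun f' g' => by
  rw [Matrix.submatrix_submatrix]
  exact hA _ _

theorem transpose {A : Matrix ι κ R} (hA : A.MinorsVanish n) : Aᵀ.MinorsVanish n :=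
  fun f g => by
    rw [← Matrix.transpose_submatrix, Matrix.det_transpose]
    exact hA _ _

theorem map {A : Matrix ι κ R} (hA : A.MinorsVanish n) {T : Type*} [CommRing T] (φ : R →+* T) :
    (A.map φ).MinorsVanish n := fun f g => by
  have := congrArg φ (hA f g)
  rwa [RingHom.map_det, map_zero] at this

/-- Replacing all entries outside a rectangle by zero preserves vanishing of minors. -/
theorem mask {A : Matrix ι κ R} (hA : A.MinorsVanish n) (p : ι → Prop) (q : κ → Prop)
    [DecidablePred p] [DecidablePred q] :
    (Matrix.of fun i j => if p i ∧ q j then A i j else 0).MinorsVanish n := fun f g => by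
  have : (Matrix.of fun i j => if p i ∧ q j then A i j else 0).submatrix f g =
      Matrix.of fun i j => (if p (f i) then 1 else 0) *
        (Matrix.of fun i j => (if q (g j) then 1 else 0) * A.submatrix f g i j) i j := by
    ext i j
    by_cases hp : p (f i) <;> by_cases hq : q (g j) <;> simp [hp, hq]
  rw [this, Matrix.det_mul_column, Matrix.det_mul_row, hA, mul_zero, mul_zero]

theorem det_submatrix_eq_zero {A : Matrix ι κ R} (hA : A.MinorsVanish n) {k : ℕ} (hk : n < k)
    (f : Fin k → ι) (g : Fin k → κ) : (A.submatrix f g).det = 0 := by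
  induction k, hk using Nat.le_induction with
  | base => exact hA f g
  | succ k _ ih =>
    rw [Matrix.det_succ_row_zero]
    refine Finset.sum_eq_zero fun j _ => ?_
    rw [Matrix.submatrix_submatrix, ih, mul_zero]

theorem minorOn_eq_zero {s : ℕ} {A : Matrix (Fin s) (Fin s) R} (hA : A.MinorsVanish n)
    {I : Finset (Fin s)} (hI : n < I.card) (K : Finset (Fin s)) : A.minorOn I K = 0 := by
  unfold Matrix.minorOn
  split_ifs
  · exact hA.det_submatrix_eq_zero hI _ _
  · rfl

theorem det_piecewise_eq_zero {s : ℕ} {A : Matrix (Fin s) (Fin s) R} (hA : A.MinorsVanish n)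
    (B : Matrix (Fin s) (Fin s) R) {N : Finset (Fin s)} (hN : n < N.card) :
    (Matrix.of (N.piecewise A B)).det = 0 := by
  rw [Matrix.det_piecewise A B rfl]
  refine Finset.sum_eq_zero fun J _ => ?_
  rw [hA.minorOn_eq_zero hN, zero_mul, smul_zero]

/-- Vanishing of minors only needs to be checked on increasing rows and columns. -/
theorem of_minorOn {s : ℕ} {A : Matrix (Fin s) (Fin s) R}
    (h : ∀ I K : Finset (Fin s), I.card = n + 1 → K.card = n + 1 → A.minorOn I K = 0) :
    A.MinorsVanish n := by
  have factor : ∀ f : Fin (n + 1) → Fin s, Function.Injective f →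
      ∃ (I : Finset (Fin s)) (hI : I.card = n + 1) (σ : Equiv.Perm (Fin (n + 1))),
        f = I.orderEmbOfFin hI ∘ σ := by
    intro f hf
    have hI : (Finset.univ.image f).card = n + 1 := by
      rw [Finset.card_image_of_injective _ hf, Finset.card_univ, Fintype.card_fin]
    have hmem : ∀ x, f x ∈ Finset.univ.image f := fun x => by simp
    let τ : Fin (n + 1) → Fin (n + 1) := fun x =>
      ((Finset.univ.image f).orderIsoOfFin hI).symm ⟨f x, hmem x⟩
    have hτ : Function.Injective τ := fun x y hxy => hf (by simpa [τ] using hxy)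
    refine ⟨_, hI, Equiv.ofBijective τ (Finite.injective_iff_bijective.1 hτ), ?_⟩
    ext x
    simp [τ, ← Finset.coe_orderIsoOfFin_apply]
  intro f g
  by_cases hf : Function.Injective f
  · by_cases hg : Function.Injective g
    · obtain ⟨I, hI, σ, rfl⟩ := factor f hf
      obtain ⟨K, hK, τ, rfl⟩ := factor g hg
      have h0 := h I K hI hK
      rw [A.minorOn_eq hI hK] at h0
      have : A.submatrix (I.orderEmbOfFin hI ∘ σ) (K.orderEmbOfFin hK ∘ τ) =
          ((A.submatrix (I.orderEmbOfFin hI) (K.orderEmbOfFin hK)).submatrix σ id).submatrix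
            id τ := rfl
      rw [this, Matrix.det_permute', Matrix.det_permute, h0, mul_zero, mul_zero]
    · simp only [Function.Injective, not_forall] at hg
      obtain ⟨x, y, hxy, hne⟩ := hg
      exact Matrix.det_zero_of_column_eq hne fun i => by simp [hxy]
  · simp only [Function.Injective, not_forall] at hf
    obtain ⟨x, y, hxy, hne⟩ := hf
    exact Matrix.det_zero_of_row_eq hne (by ext i; simp [hxy])

end Matrix.MinorsVanish

/-- The sum of the determinants having `k` rows from `A` and the others from `B`. -/
noncomputable def Matrix.mixedDet {s : ℕ} {R : Type*} [CommRing R] (k : ℕ)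
    (A B : Matrix (Fin s) (Fin s) R) : R :=
  ∑ N ∈ Finset.powersetCard k Finset.univ, (Matrix.of (N.piecewise A B)).det

theorem Matrix.MinorsVanish.mixedDet_eq_zero {s n k : ℕ} {R : Type*} [CommRing R]
    {A : Matrix (Fin s) (Fin s) R} (hA : A.MinorsVanish n) (hk : n < k)
    (B : Matrix (Fin s) (Fin s) R) : Matrix.mixedDet k A B = 0 :=
  Finset.sum_eq_zero fun N hN => hA.det_piecewise_eq_zero B <| by
    rwa [(Finset.mem_powersetCard.1 hN).2]

theorem Matrix.mixedDet_eq_zero_of_lt {s k : ℕ} {R : Type*} [CommRing R] (hk : s < k)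
    (A B : Matrix (Fin s) (Fin s) R) : Matrix.mixedDet k A B = 0 := by
  rw [Matrix.mixedDet, Finset.powersetCard_eq_empty.2 (by simpa using hk), Finset.sum_empty]

theorem Matrix.det_smul_add_smul {s : ℕ} {R : Type*} [CommRing R]
    (A B : Matrix (Fin s) (Fin s) R) (v w : R) :
    (v • A + w • B).det =
      ∑ k ∈ Finset.range (s + 1), v ^ k * w ^ (s - k) * Matrix.mixedDet k A B := by
  have h := (Matrix.detRowAlternating (n := Fin s) (R := R)).map_add_univ
    (fun i => v • A i) (fun i => w • B i)
  have h0 : (v • A + w • B).det = Matrix.detRowAlternating ((fun i => v • A i) + fun i => w • B i) :=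
    rfl
  rw [h0, h, ← Finset.powerset_univ, Finset.sum_powerset, Finset.card_univ, Fintype.card_fin]
  refine Finset.sum_congr rfl fun k _ => ?_
  rw [Matrix.mixedDet, Finset.mul_sum]
  refine Finset.sum_congr rfl fun N hN => ?_
  have hN := (Finset.mem_powersetCard.1 hN).2
  have h1 : (N.piecewise (fun i => v • A i) fun i => w • B i) = fun i =>
      (if i ∈ N then v else w) • (Matrix.of (N.piecewise A B)) i := by
    ext i j
    by_cases hi : i ∈ N <;> simp [hi, Finset.piecewise]
  rw [h1]
  refine ((Matrix.detRowAlternating (n := Fin s) (R := R)).map_smul_univ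
    (fun i => if i ∈ N then v else w) (Matrix.of (N.piecewise A B))).trans ?_
  rw [Finset.prod_ite]
  simp only [Finset.prod_const, smul_eq_mul]
  congr 2
  · congr 1
    rw [← hN]
    congr 1
    ext
    simp
  · congr 1
    rw [Finset.filter_not, Finset.card_sdiff]
    simp [hN]

theorem Matrix.map_mixedDet {s k : ℕ} {R T : Type*} [CommRing R] [CommRing T] (φ : R →+* T)
    (A B : Matrix (Fin s) (Fin s) R) :
    Matrix.mixedDet k (A.map φ) (B.map φ) = φ (Matrix.mixedDet k A B) := by
  rw [Matrix.mixedDet, Matrix.mixedDet, map_sum]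
  refine Finset.sum_congr rfl fun N _ => ?_
  rw [RingHom.map_det]
  congr 1
  ext i j
  by_cases hi : i ∈ N <;> simp [hi, Finset.piecewise]

theorem Matrix.coeff_det_X_smul_add {s : ℕ} {R : Type*} [CommRing R] (k : ℕ)
    (A B : Matrix (Fin s) (Fin s) R) :
    ((Polynomial.X : Polynomial R) • A.map Polynomial.C + B.map Polynomial.C).det.coeff k =
      Matrix.mixedDet k A B := by
  have h := Matrix.det_smul_add_smul (A.map (Polynomial.C : R →+* _))
    (B.map (Polynomial.C : R →+* _)) Polynomial.X 1
  simp only [one_smul, one_pow, mul_one, Matrix.map_mixedDet] at h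
  rw [h, Polynomial.finsetSum_coeff]
  simp only [Polynomial.coeff_X_pow_mul', Polynomial.coeff_C]
  by_cases hk : s < k
  · rw [Matrix.mixedDet_eq_zero_of_lt hk]
    refine Finset.sum_eq_zero fun j hj => ?_
    have := Finset.mem_range.1 hj
    rw [if_pos (by omega), if_neg (by omega)]
  · rw [Finset.sum_eq_single_of_mem k (Finset.mem_range.2 (by omega))]
    · simp
    · intro j _ hj
      split_ifs <;> first | rfl | omega

namespace Matrix.MinorsVanish

variable {s n : ℕ} {R : Type*} [CommRing R] {t : R} {a c : Matrix (Fin s) (Fin s) R}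

theorem mixedDet_add_smul (ha : a.MinorsVanish n) (hn : n ≤ s) (t : R)
    (b : Matrix (Fin s) (Fin s) R) :
    Matrix.mixedDet n a (a + t • b) = t ^ (s - n) * Matrix.mixedDet n a b := by
  have h : (Polynomial.X : Polynomial R) • a.map Polynomial.C + (a + t • b).map Polynomial.C =
      ((Polynomial.X : Polynomial R) + 1) • a.map (Polynomial.C : R →+* Polynomial R) +
        Polynomial.C t • b.map (Polynomial.C : R →+* Polynomial R) := by
    ext1 i j
    simp
    ring
  rw [← Matrix.coeff_det_X_smul_add, h, Matrix.det_smul_add_smul, Polynomial.finsetSum_coeff]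
  simp only [Matrix.map_mixedDet, ← Polynomial.C_pow, mul_assoc, ← Polynomial.C_mul,
    Polynomial.coeff_mul_C, Polynomial.coeff_X_add_one_pow]
  rw [Finset.sum_eq_single_of_mem n (Finset.mem_range.2 (by omega))]
  · simp
  · intro k _ hk
    rcases lt_or_gt_of_ne hk with h | h
    · simp [Nat.choose_eq_zero_of_lt h]
    · simp [ha.mixedDet_eq_zero h]

theorem pow_dvd_mixedDet_of_add_smul (ht : t ∈ nonZeroDivisors R) (ha : a.MinorsVanish n)
    (b : Matrix (Fin s) (Fin s) R) (hc : (a + t • b).MinorsVanish n) (hn : n ≤ s) :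
    t ^ (s - n) ∣ Matrix.mixedDet n a b := by
  set m := s - n with hm
  set q : Polynomial R := ∑ k ∈ Finset.range (n + 1),
    (Polynomial.C t * Polynomial.X) ^ (n - k) * Polynomial.C (Matrix.mixedDet k a b) with hq
  have h1 : (a.map (Polynomial.C : R →+* Polynomial R) + (Polynomial.C t * Polynomial.X) •
      b.map (Polynomial.C : R →+* Polynomial R)).det =
      Polynomial.X ^ m * (Polynomial.C (t ^ m) * q) := by
    have h := Matrix.det_smul_add_smul (a.map (Polynomial.C : R →+* Polynomial R))
      (b.map (Polynomial.C : R →+* _)) 1 (Polynomial.C t * Polynomial.X)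
    simp only [one_smul, one_pow, one_mul, Matrix.map_mixedDet] at h
    rw [h, ← Finset.sum_subset (Finset.range_mono (show n + 1 ≤ s + 1 by omega)), ← mul_assoc,
      Polynomial.C_pow, mul_comm (Polynomial.X ^ m), ← mul_pow, hq, Finset.mul_sum]
    · refine Finset.sum_congr rfl fun k hk => ?_
      have := Finset.mem_range.1 hk
      rw [← mul_assoc, ← pow_add]
      congr 2
      omega
    · intro k _ hk
      rw [ha.mixedDet_eq_zero (by simpa using hk)]
      simp
  have h2 : (Polynomial.X - Polynomial.C 1) ^ m ∣ (a.map (Polynomial.C : R →+* Polynomial R) +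
      (Polynomial.C t * Polynomial.X) • b.map (Polynomial.C : R →+* Polynomial R)).det := by
    have h : a.map (Polynomial.C : R →+* Polynomial R) +
      (Polynomial.C t * Polynomial.X) • b.map (Polynomial.C : R →+* Polynomial R) =
        (Polynomial.X : Polynomial R) • (a + t • b).map (Polynomial.C : R →+* Polynomial R) +
        ((1 : Polynomial R) - Polynomial.X) • a.map (Polynomial.C : R →+* Polynomial R) := by
      ext1 i j
      simp
      ring
    rw [h, Matrix.det_smul_add_smul]
    refine Finset.dvd_sum fun k _ => ?_
    by_cases hk : n < k
    · rw [(hc.map _).mixedDet_eq_zero hk, mul_zero]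
      exact dvd_zero _
    · refine Dvd.dvd.mul_right (Dvd.dvd.mul_left ?_ _) _
      refine (pow_dvd_pow _ (show m ≤ s - k by omega)).trans (pow_dvd_pow_of_dvd ?_ _)
      exact ⟨-1, by simp⟩
  have hmonic : ((Polynomial.X - Polynomial.C (1 : R)) ^ m).Monic :=
    (Polynomial.monic_X_sub_C 1).pow m
  have h3 : (Polynomial.X - Polynomial.C 1) ^ m ∣ q := by
    have hcop : IsCoprime ((Polynomial.X - Polynomial.C (1 : R)) ^ m) (Polynomial.X ^ m) :=
      IsCoprime.pow ⟨-1, 1, by simp⟩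
    rw [h1] at h2
    have h := hcop.dvd_of_dvd_mul_left h2
    rw [← Polynomial.modByMonic_eq_zero_iff_dvd hmonic] at h ⊢
    rw [← Polynomial.smul_eq_C_mul, Polynomial.smul_modByMonic] at h
    ext i
    have hi := congrArg (fun r => Polynomial.coeff r i) h
    simp only [Polynomial.coeff_smul, Polynomial.coeff_zero, smul_eq_mul] at hi ⊢
    exact (mem_nonZeroDivisors_iff.1 (pow_mem ht m)).1 _ hi
  rw [← Ideal.mem_span_singleton, ← Ideal.Quotient.eq_zero_iff_mem]
  rcases subsingleton_or_nontrivial (R ⧸ Ideal.span {t ^ m}) with hs | hs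
  · exact Subsingleton.elim _ _
  set φ := Ideal.Quotient.mk (Ideal.span {t ^ m}) with hφ
  have hφt : φ t ^ m = 0 := by
    rw [← map_pow]
    exact Ideal.Quotient.eq_zero_iff_mem.2 (Ideal.mem_span_singleton_self _)
  have hdeg : (q.map φ).degree < (Polynomial.map φ ((Polynomial.X - Polynomial.C (1 : R)) ^ m)).degree := by
    have hd : (Polynomial.map φ ((Polynomial.X - Polynomial.C (1 : R)) ^ m)).degree = m := by
      rw [Polynomial.map_pow, Polynomial.map_sub, Polynomial.map_X, Polynomial.map_C,
        Polynomial.degree_pow' (by rw [(Polynomial.monic_X_sub_C (φ 1)).leadingCoeff]; simp),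
        Polynomial.degree_X_sub_C]
      simp
    rw [hd, Polynomial.degree_lt_iff_coeff_zero]
    intro i hi
    rw [Polynomial.coeff_map, hq, Polynomial.finsetSum_coeff, map_sum]
    refine Finset.sum_eq_zero fun k _ => ?_
    rw [Polynomial.coeff_mul_C, mul_pow, ← Polynomial.C_pow, Polynomial.coeff_C_mul_X_pow]
    split_ifs with h
    · rw [map_mul, map_pow, ← h, pow_eq_zero_of_le hi hφt, zero_mul]
    · simp
  have h4 : q.map φ = 0 := by
    have := (Polynomial.modByMonic_eq_zero_iff_dvd (hmonic.map φ)).2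
      (Polynomial.map_dvd φ h3)
    rwa [(Polynomial.modByMonic_eq_self_iff (hmonic.map φ)).2 hdeg] at this
  have h5 := congrArg (fun r => Polynomial.coeff r 0) h4
  simp only [Polynomial.coeff_map, Polynomial.coeff_zero] at h5
  rw [← h5, hq, Polynomial.finsetSum_coeff, Finset.sum_eq_single_of_mem n (by simp)]
  · simp
  · intro k hk hne
    have := Finset.mem_range.1 hk
    simp [zero_pow (show n - k ≠ 0 by omega),
      Polynomial.coeff_zero_eq_eval_zero]

theorem pow_dvd_mixedDet (ht : t ∈ nonZeroDivisors R) (ha : a.MinorsVanish n)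
    {b : Matrix (Fin s) (Fin s) R} (hc : (a + t • b).MinorsVanish n) :
    t ^ (2 * (s - n)) ∣ Matrix.mixedDet n a (a + t • b) := by
  rcases le_total n s with hn | hn
  · rw [ha.mixedDet_add_smul hn, two_mul, pow_add]
    exact mul_dvd_mul_left _ (ha.pow_dvd_mixedDet_of_add_smul ht b hc hn)
  · simp [Nat.sub_eq_zero_of_le hn]

end Matrix.MinorsVanish

/-- The matrix `c + u a'`, where `u` is the polynomial variable and `a'` is obtained from `a` by
replacing the rows in `L` and the columns in `K` by zero. -/
noncomputable def Matrix.maskedPencil {s : ℕ} {R : Type*} [CommRing R]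
    (a c : Matrix (Fin s) (Fin s) R) (L K : Finset (Fin s)) :
    Matrix (Fin s) (Fin s) (Polynomial R) :=
  Matrix.of fun i j =>
    Polynomial.C (c i j) + if i ∉ L ∧ j ∉ K then Polynomial.X * Polynomial.C (a i j) else 0

theorem Finset.card_filter_succAbove_mem {s : ℕ} (L : Finset (Fin (s + 1))) (i : Fin (s + 1)) :
    (Finset.univ.filter fun x => i.succAbove x ∈ L).card + (if i ∈ L then 1 else 0) =
      L.card := by
  rw [Finset.card_filter, ← Finset.filter_univ_mem L, Finset.card_filter,
    Fin.sum_univ_succAbove _ i, add_comm]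
  simp

namespace Matrix

variable {s n : ℕ} {R : Type*} [CommRing R] {t : R}

theorem maskedPencil_transpose (a c : Matrix (Fin s) (Fin s) R) (L K : Finset (Fin s)) :
    (maskedPencil a c L K)ᵀ = maskedPencil aᵀ cᵀ K L := by
  ext1 i j
  simp [maskedPencil, and_comm]

theorem maskedPencil_submatrix (a c : Matrix (Fin (s + 1)) (Fin (s + 1)) R)
    (L K : Finset (Fin (s + 1))) (i j : Fin (s + 1)) :
    (maskedPencil a c L K).submatrix i.succAbove j.succAbove =
      maskedPencil (a.submatrix i.succAbove j.succAbove) (c.submatrix i.succAbove j.succAbove)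
        (Finset.univ.filter fun x => i.succAbove x ∈ L)
        (Finset.univ.filter fun x => j.succAbove x ∈ K) := by
  ext1 x y
  simp [maskedPencil]

theorem MinorsVanish.coeff_det_maskedPencil {a : Matrix (Fin s) (Fin s) R}
    (ha : a.MinorsVanish n) (b : Matrix (Fin s) (Fin s) R) (L K : Finset (Fin s)) {i : Fin s}
    (hi : i ∈ L) :
    (maskedPencil a (a + t • b) L K).det.coeff n =
      ((maskedPencil a (a + t • b) L K).updateRow i fun j =>
        Polynomial.C (if j ∈ K then (a + t • b) i j else t * b i j)).det.coeff n := by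
  set c := a + t • b with hc
  set r₁ : Fin s → Polynomial R := fun j => Polynomial.C (if j ∈ K then c i j else t * b i j)
  set r₂ : Fin s → Polynomial R := fun j => Polynomial.C (if j ∉ K then a i j else 0)
  have hrow : maskedPencil a c L K = (maskedPencil a c L K).updateRow i (r₁ + r₂) := by
    rw [← Matrix.updateRow_eq_self (maskedPencil a c L K) i, Matrix.updateRow_idem]
    congr 1
    ext1 j
    by_cases hj : j ∈ K <;> simp [maskedPencil, hi, hj, r₁, r₂, hc, add_comm]
  have hzero : ((maskedPencil a c L K).updateRow i r₂).det.coeff n = 0 := by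
    set A : Matrix (Fin s) (Fin s) R :=
      Matrix.of fun x y => if (x ∉ L ∨ x = i) ∧ y ∉ K then a x y else 0 with hA
    have hAv : A.MinorsVanish n := ha.mask _ _
    set B : Matrix (Fin s) (Fin s) R := c.updateRow i 0 with hB
    have h : (maskedPencil a c L K).updateRow i ((Polynomial.X : Polynomial R) • r₂) =
        (Polynomial.X : Polynomial R) • A.map Polynomial.C + B.map Polynomial.C := by
      ext1 x y
      by_cases hx : x = i
      · subst hx
        by_cases hy : y ∈ K <;> simp [r₂, hA, hB, hy]
      · by_cases hxL : x ∈ L <;> by_cases hy : y ∈ K <;>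
          simp [maskedPencil, hA, hB, hx, hxL, hy, add_comm]
    rw [← Polynomial.coeff_X_mul, ← Matrix.det_updateRow_smul, h, Matrix.coeff_det_X_smul_add]
    exact hAv.mixedDet_eq_zero (Nat.lt_succ_self n) B
  conv_lhs => rw [hrow, Matrix.det_updateRow_add, Polynomial.coeff_add, hzero, add_zero]

theorem MinorsVanish.pow_dvd_coeff_det_maskedPencil_succ
    (ih : ∀ (a b : Matrix (Fin s) (Fin s) R), a.MinorsVanish n → (a + t • b).MinorsVanish n →
      ∀ L K : Finset (Fin s), t ^ (2 * s - 2 * n - L.card - K.card) ∣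
        (maskedPencil a (a + t • b) L K).det.coeff n)
    {a b : Matrix (Fin (s + 1)) (Fin (s + 1)) R} (ha : a.MinorsVanish n)
    (hc : (a + t • b).MinorsVanish n) (L K : Finset (Fin (s + 1))) (hL : L.Nonempty) :
    t ^ (2 * (s + 1) - 2 * n - L.card - K.card) ∣
      (maskedPencil a (a + t • b) L K).det.coeff n := by
  obtain ⟨i, hi⟩ := hL
  rw [ha.coeff_det_maskedPencil b L K hi, Matrix.det_succ_row _ i, Polynomial.finsetSum_coeff]
  refine Finset.dvd_sum fun j _ => ?_
  rw [Matrix.submatrix_updateRow_succAbove, maskedPencil_submatrix, mul_assoc,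
    Matrix.updateRow_self, show ((-1 : Polynomial R) ^ ((i : ℕ) + j)) =
      Polynomial.C ((-1) ^ ((i : ℕ) + j)) by simp, Polynomial.coeff_C_mul, Polynomial.coeff_C_mul]
  refine Dvd.dvd.mul_left ?_ _
  have hsub : (a + t • b).submatrix i.succAbove j.succAbove =
      a.submatrix i.succAbove j.succAbove + t • b.submatrix i.succAbove j.succAbove := rfl
  have h := ih _ (b.submatrix i.succAbove j.succAbove)
    (ha.submatrix i.succAbove j.succAbove) (hc.submatrix i.succAbove j.succAbove)
    (Finset.univ.filter fun x => i.succAbove x ∈ L) (Finset.univ.filter fun x => j.succAbove x ∈ K)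
  have hLc := Finset.card_filter_succAbove_mem L i
  have hKc := Finset.card_filter_succAbove_mem K j
  rw [if_pos hi] at hLc
  rw [hsub]
  by_cases hj : j ∈ K
  · rw [if_pos hj] at hKc ⊢
    refine Dvd.dvd.mul_left ((pow_dvd_pow t ?_).trans h) _
    omega
  · rw [if_neg hj] at hKc ⊢
    rw [mul_assoc]
    refine (pow_dvd_pow t ?_).trans ((pow_succ' t _).symm ▸
      mul_dvd_mul_left t (h.trans (dvd_mul_left _ _)))
    omega

theorem MinorsVanish.pow_dvd_coeff_det_maskedPencil (ht : t ∈ nonZeroDivisors R)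
    (a b : Matrix (Fin s) (Fin s) R) (ha : a.MinorsVanish n) (hc : (a + t • b).MinorsVanish n)
    (L K : Finset (Fin s)) :
    t ^ (2 * s - 2 * n - L.card - K.card) ∣ (maskedPencil a (a + t • b) L K).det.coeff n := by
  have base : ∀ {s : ℕ} (a b : Matrix (Fin s) (Fin s) R), a.MinorsVanish n →
      (a + t • b).MinorsVanish n → t ^ (2 * s - 2 * n) ∣
        (maskedPencil a (a + t • b) ∅ ∅).det.coeff n := by
    intro s a b ha hc
    have h : maskedPencil a (a + t • b) ∅ ∅ =
        (Polynomial.X : Polynomial R) • a.map Polynomial.C + (a + t • b).map Polynomial.C := by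
      ext1 i j
      simp [maskedPencil, add_comm]
    rw [h, Matrix.coeff_det_X_smul_add, ← Nat.mul_sub]
    exact ha.pow_dvd_mixedDet ht hc
  induction s with
  | zero =>
    rw [Finset.eq_empty_of_isEmpty L, Finset.eq_empty_of_isEmpty K]
    simp
  | succ s ih =>
    rcases L.eq_empty_or_nonempty with rfl | hL
    · rcases K.eq_empty_or_nonempty with rfl | hK
      · simpa using base a b ha hc
      · rw [← Matrix.det_transpose, maskedPencil_transpose, Matrix.transpose_add,
          Matrix.transpose_smul, Nat.sub_right_comm]
        refine MinorsVanish.pow_dvd_coeff_det_maskedPencil_succ ih ha.transpose ?_ _ _ hK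
        simpa using hc.transpose
    · exact MinorsVanish.pow_dvd_coeff_det_maskedPencil_succ ih ha hc _ _ hL

end Matrix

theorem Finset.pow_dvd_sum_powersetCard_filter {s n d : ℕ} {R : Type*} [CommRing R] {t : R}
    {f : Finset (Fin s) → R}
    (h : ∀ L₁ : Finset (Fin s), t ^ (d - L₁.card) ∣ ∑ N ∈ Finset.powersetCard n L₁ᶜ, f N)
    (L₀ L₁ : Finset (Fin s)) :
    t ^ (d - L₀.card - L₁.card) ∣
      ∑ N ∈ (Finset.powersetCard n L₁ᶜ).filter (fun N => L₀ ⊆ N), f N := by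
  induction L₀ using Finset.induction_on generalizing L₁ with
  | empty => simpa using h L₁
  | insert i L₀ hi ih =>
    have key : ∑ N ∈ (Finset.powersetCard n L₁ᶜ).filter (fun N => insert i L₀ ⊆ N), f N =
        ∑ N ∈ (Finset.powersetCard n L₁ᶜ).filter (fun N => L₀ ⊆ N), f N -
        ∑ N ∈ (Finset.powersetCard n (insert i L₁)ᶜ).filter (fun N => L₀ ⊆ N), f N := by
      rw [eq_sub_iff_add_eq, ← Finset.sum_filter_add_sum_filter_not
        ((Finset.powersetCard n L₁ᶜ).filter (fun N => L₀ ⊆ N)) (fun N => i ∈ N),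
        Finset.filter_filter, Finset.filter_filter]
      congr 1
      · refine Finset.sum_congr (Finset.filter_congr fun N _ => ?_) fun _ _ => rfl
        rw [Finset.insert_subset_iff, and_comm]
      · refine Finset.sum_congr ?_ fun _ _ => rfl
        ext N
        simp only [Finset.mem_filter, Finset.mem_powersetCard, Finset.compl_insert,
          Finset.subset_erase]
        tauto
    rw [key, Finset.card_insert_of_notMem hi]
    refine dvd_sub ((pow_dvd_pow t ?_).trans (ih L₁)) ((pow_dvd_pow t ?_).trans (ih (insert i L₁)))
    · omega
    · have := Finset.card_insert_le i L₁
      omega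

namespace Matrix

variable {s n : ℕ} {R : Type*} [CommRing R] {t : R}

theorem minorOn_mask (A : Matrix (Fin s) (Fin s) R) (L K : Finset (Fin s)) {N J : Finset (Fin s)}
    (hNJ : J.card = N.card) :
    (Matrix.of fun i j => if i ∉ L ∧ j ∉ K then A i j else 0).minorOn N J =
      if N ⊆ Lᶜ ∧ J ⊆ Kᶜ then A.minorOn N J else 0 := by
  rw [Matrix.minorOn_eq _ rfl hNJ, Matrix.minorOn_eq _ rfl hNJ]
  split_ifs with h
  · congr 1
    ext a b
    have h1 := Finset.mem_compl.1 (h.1 (N.orderEmbOfFin_mem rfl a))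
    have h2 := Finset.mem_compl.1 (h.2 (J.orderEmbOfFin_mem hNJ b))
    simp [h1, h2]
  · rw [not_and_or] at h
    rcases h with h | h
    · obtain ⟨x, hx, hxL⟩ := Finset.not_subset.1 h
      obtain ⟨a, rfl⟩ : x ∈ Set.range (N.orderEmbOfFin rfl) := by
        rwa [Finset.range_orderEmbOfFin]
      refine Matrix.det_eq_zero_of_row_eq_zero a fun b => ?_
      simp at hxL
      simp [hxL]
    · obtain ⟨x, hx, hxK⟩ := Finset.not_subset.1 h
      obtain ⟨b, rfl⟩ : x ∈ Set.range (J.orderEmbOfFin hNJ) := by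
        rwa [Finset.range_orderEmbOfFin]
      refine Matrix.det_eq_zero_of_column_eq_zero b fun a => ?_
      simp at hxK
      simp [hxK]

theorem coeff_det_maskedPencil (A B : Matrix (Fin s) (Fin s) R) (L K : Finset (Fin s)) :
    (maskedPencil A B L K).det.coeff n =
      ∑ N ∈ Finset.powersetCard n Lᶜ, ∑ J ∈ Finset.powersetCard n Kᶜ,
        epsSign s N J • (A.minorOn N J * B.minorOn Nᶜ Jᶜ) := by
  set A' : Matrix (Fin s) (Fin s) R :=
    Matrix.of fun i j => if i ∉ L ∧ j ∉ K then A i j else 0 with hA'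
  have h : maskedPencil A B L K =
      (Polynomial.X : Polynomial R) • A'.map Polynomial.C + B.map Polynomial.C := by
    ext1 i j
    by_cases hi : i ∈ L <;> by_cases hj : j ∈ K <;>
      simp [maskedPencil, hA', hi, hj, add_comm]
  have hsub : ∀ P : Finset (Fin s),
      Finset.powersetCard n Pᶜ ⊆ Finset.powersetCard n Finset.univ := fun P =>
    Finset.powersetCard_mono (Finset.subset_univ _)
  rw [h, Matrix.coeff_det_X_smul_add, Matrix.mixedDet]
  have hterm : ∀ N ∈ Finset.powersetCard n (Finset.univ : Finset (Fin s)),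
      (Matrix.of (N.piecewise A' B)).det =
      if N ⊆ Lᶜ then ∑ J ∈ Finset.powersetCard n Kᶜ,
        epsSign s N J • (A.minorOn N J * B.minorOn Nᶜ Jᶜ) else 0 := by
    intro N hN
    have hN := (Finset.mem_powersetCard.1 hN).2
    rw [Matrix.det_piecewise A' B hN]
    split_ifs with hNL
    · rw [← Finset.sum_subset (hsub K)]
      · refine Finset.sum_congr rfl fun J hJ => ?_
        obtain ⟨hJK, hJ⟩ := Finset.mem_powersetCard.1 hJ
        rw [hA', minorOn_mask A L K (hJ.trans hN.symm), if_pos ⟨hNL, hJK⟩]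
      · intro J hJ hJK
        have hJ := (Finset.mem_powersetCard.1 hJ).2
        rw [Finset.mem_powersetCard, not_and_or] at hJK
        rw [hA', minorOn_mask A L K (hJ.trans hN.symm), if_neg (by tauto), zero_mul, smul_zero]
    · refine Finset.sum_eq_zero fun J hJ => ?_
      have hJ := (Finset.mem_powersetCard.1 hJ).2
      rw [hA', minorOn_mask A L K (hJ.trans hN.symm), if_neg (by tauto), zero_mul, smul_zero]
  rw [Finset.sum_congr rfl hterm, ← Finset.sum_filter]
  refine Finset.sum_congr ?_ fun _ _ => rfl
  ext N
  simp [Finset.mem_powersetCard, and_comm]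

theorem MinorsVanish.pow_dvd_sum_minorOn (ht : t ∈ nonZeroDivisors R)
    {a b : Matrix (Fin s) (Fin s) R} (ha : a.MinorsVanish n) (hc : (a + t • b).MinorsVanish n)
    (L₀ L₁ K₀ K₁ : Finset (Fin s)) :
    t ^ (2 * s - 2 * n - K₀.card - K₁.card - L₀.card - L₁.card) ∣
      ∑ N ∈ (Finset.powersetCard n L₁ᶜ).filter (fun N => L₀ ⊆ N),
        ∑ J ∈ (Finset.powersetCard n K₁ᶜ).filter (fun J => K₀ ⊆ J),
          epsSign s N J • (a.minorOn N J * (a + t • b).minorOn Nᶜ Jᶜ) := by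
  refine Finset.pow_dvd_sum_powersetCard_filter (fun L₁ => ?_) L₀ L₁
  rw [Finset.sum_comm, Nat.sub_right_comm, Nat.sub_right_comm (2 * s - 2 * n)]
  refine Finset.pow_dvd_sum_powersetCard_filter (fun K₁ => ?_) K₀ K₁
  rw [Finset.sum_comm, ← Matrix.coeff_det_maskedPencil]
  exact MinorsVanish.pow_dvd_coeff_det_maskedPencil ht a b ha hc L₁ K₁

end Matrix

/-- The Taylor homomorphism `p ↦ ∑ r, (∂^r p / r!) t^r`. -/
noncomputable def taylorSeries (s : ℕ) : PolyS s →ₐ[ℤ] PowerSeries (PolyS s) :=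
  aeval fun v => PowerSeries.mk fun r =>
    ((v.2.2 + r).choose r : PolyS s) * X (v.1, v.2.1, v.2.2 + r)

theorem constantCoeff_taylorSeries (s : ℕ) (p : PolyS s) :
    PowerSeries.constantCoeff (taylorSeries s p) = p := by
  induction p using MvPolynomial.induction_on with
  | C a => simp [taylorSeries]
  | add p q hp hq => rw [map_add, map_add, hp, hq]
  | mul_X p v hp =>
    rw [map_mul, map_mul, hp, ← PowerSeries.coeff_zero_eq_constantCoeff_apply]
    simp [taylorSeries]

theorem derivative_taylorSeries (s : ℕ) (p : PolyS s) :
    PowerSeries.derivative (PolyS s) (taylorSeries s p) = taylorSeries s (dFull s p) := by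
  induction p using MvPolynomial.induction_on with
  | C a => simp [taylorSeries]
  | add p q hp hq => simp only [map_add, hp, hq]
  | mul_X p v hp =>
    have hX : PowerSeries.derivative (PolyS s) (taylorSeries s (X v)) =
        taylorSeries s (dFull s (X v)) := by
      ext1 r
      simp only [taylorSeries, dFull, mkDerivation_X, aeval_X, map_zsmul, PowerSeries.coeff_mk,
        PowerSeries.coeff_derivative]
      have h1 : v.2.2 + (r + 1) = v.2.2 + 1 + r := by ring
      have h2 : ((v.2.2 + 1 + r).choose (r + 1) : PolyS s) * (r + 1) =
          (v.2.2 + 1) * ((v.2.2 + 1 + r).choose r) := by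
        have := Nat.choose_succ_right_eq (v.2.2 + 1 + r) r
        rw [Nat.add_sub_cancel] at this
        exact_mod_cast this.trans (mul_comm _ _)
      rw [h1, mul_right_comm, h2, zsmul_eq_mul]
      push_cast
      ring
    rw [map_mul, Derivation.leibniz, Derivation.leibniz, hp, hX, map_add, smul_eq_mul, smul_eq_mul,
      smul_eq_mul, smul_eq_mul, map_mul, map_mul]

theorem factorial_smul_coeff_taylorSeries (s r : ℕ) (p : PolyS s) :
    (r.factorial : ℤ) • PowerSeries.coeff r (taylorSeries s p) = (⇑(dFull s))^[r] p := by
  induction r generalizing p with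
  | zero => simp [constantCoeff_taylorSeries]
  | succ r ih =>
    rw [Function.iterate_succ_apply, ← ih, ← derivative_taylorSeries, PowerSeries.coeff_derivative,
      Nat.factorial_succ]
    simp only [zsmul_eq_mul]
    push_cast
    ring

theorem minorA_eq_minorOn (s : ℕ) (I K : Finset (Fin s)) :
    minorA s I K = (Matrix.of fun i j => (X (i, j, 0) : PolyS s)).minorOn I K := rfl

theorem PowerSeries.X_mem_nonZeroDivisors {R : Type*} [CommRing R] :
    (PowerSeries.X : PowerSeries R) ∈ nonZeroDivisors (PowerSeries R) :=
  mem_nonZeroDivisors_iff_right.2 fun p hp =>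
    PowerSeries.X_mul_cancel (by rw [mul_comm, hp, mul_zero])

theorem minorsVanish_map_taylorSeries {s n : ℕ} {D : Type*} [CommRing D] {f : PolyS s →+* D}
    (hf : minorIdealS s (n + 1) ≤ RingHom.ker f) :
    ((Matrix.of fun i j => (X (i, j, 0) : PolyS s)).map
      ((PowerSeries.map f).comp
        (taylorSeries s : PolyS s →+* PowerSeries (PolyS s)))).MinorsVanish n := by
  refine Matrix.MinorsVanish.of_minorOn fun I K hI hK => ?_
  rw [← Matrix.map_minorOn, ← minorA_eq_minorOn]
  ext r
  simp only [RingHom.comp_apply, RingHom.coe_coe, PowerSeries.coeff_map, map_zero]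
  exact hf (Ideal.subset_span ⟨r, I, K, hI, hK, factorial_smul_coeff_taylorSeries s r _⟩)

theorem eq_sum_of_factorial_smul_eq_Fraw {s n l : ℕ} {L0 L1 K0 K1 : Finset (Fin s)} {g : PolyS s}
    (hg : (l.factorial : ℤ) • g = Fraw s L0 L1 K0 K1 n 0 l) :
    g = ∑ N ∈ (Finset.powersetCard n L1ᶜ).filter (fun N => L0 ⊆ N),
      ∑ J ∈ (Finset.powersetCard n K1ᶜ).filter (fun J => K0 ⊆ J),
        epsSign s N J •
          (minorA s N J * PowerSeries.coeff l (taylorSeries s (minorA s Nᶜ Jᶜ))) := by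
  refine smul_right_injective (PolyS s)
    (Int.natCast_ne_zero.2 l.factorial_ne_zero) (hg.trans ?_)
  simp only [Fraw, Finset.smul_sum, Function.iterate_zero, id_eq]
  refine Finset.sum_congr rfl fun N _ => Finset.sum_congr rfl fun J _ => ?_
  rw [← factorial_smul_coeff_taylorSeries, mul_smul_comm, smul_comm]

theorem map_sum_minorA_mul_coeff_taylorSeries {s n l : ℕ} {L0 L1 K0 K1 : Finset (Fin s)}
    (hl : l + L0.card + L1.card + K0.card + K1.card + 1 + 2 * n ≤ 2 * s)
    {D : Type*} [CommRing D] {f : PolyS s →+* D} (hf : minorIdealS s (n + 1) ≤ RingHom.ker f) :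
    f (∑ N ∈ (Finset.powersetCard n L1ᶜ).filter (fun N => L0 ⊆ N),
      ∑ J ∈ (Finset.powersetCard n K1ᶜ).filter (fun J => K0 ⊆ J),
        epsSign s N J •
          (minorA s N J * PowerSeries.coeff l (taylorSeries s (minorA s Nᶜ Jᶜ)))) = 0 := by
  set x : Matrix (Fin s) (Fin s) (PolyS s) := Matrix.of fun i j => X (i, j, 0) with hx
  set ψ : PolyS s →+* PowerSeries D :=
    (PowerSeries.map f).comp (taylorSeries s : PolyS s →+* PowerSeries (PolyS s)) with hψ
  set φ : PolyS s →+* PowerSeries D := PowerSeries.C.comp f with hφ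
  have hφψ : φ = (PowerSeries.C.comp PowerSeries.constantCoeff).comp ψ := by
    refine RingHom.ext fun p => ?_
    simp only [hφ, hψ, RingHom.comp_apply, RingHom.coe_coe]
    rw [← PowerSeries.coeff_zero_eq_constantCoeff_apply, PowerSeries.coeff_map,
      PowerSeries.coeff_zero_eq_constantCoeff_apply, constantCoeff_taylorSeries]
  have hc : (x.map ψ).MinorsVanish n := minorsVanish_map_taylorSeries hf
  have ha : (x.map φ).MinorsVanish n := by
    rw [hφψ, RingHom.coe_comp, ← Matrix.map_map]
    exact hc.map (PowerSeries.C.comp PowerSeries.constantCoeff)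
  obtain ⟨b, hb⟩ : ∃ b : Matrix (Fin s) (Fin s) (PowerSeries D),
      x.map ψ = x.map φ + (PowerSeries.X : PowerSeries D) • b := by
    have h : ∀ i j, (PowerSeries.X : PowerSeries D) ∣ ψ (x i j) - φ (x i j) := fun i j => by
      rw [PowerSeries.X_dvd_iff, hφψ]
      simp only [map_sub, RingHom.comp_apply, PowerSeries.constantCoeff_C, sub_self]
    choose b hb using h
    exact ⟨Matrix.of b, by ext1 i j; simp [← hb]⟩
  have hdvd := Matrix.MinorsVanish.pow_dvd_sum_minorOn (R := PowerSeries D)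
    PowerSeries.X_mem_nonZeroDivisors ha (b := b) (by rwa [← hb]) L0 L1 K0 K1
  rw [← hb] at hdvd
  replace hdvd := PowerSeries.X_pow_dvd_iff.1 hdvd l (by omega)
  rw [← hdvd]
  simp only [map_sum, map_zsmul, ← Matrix.map_minorOn, ← minorA_eq_minorOn, map_mul, hφ, hψ, hx,
    RingHom.comp_apply, RingHom.coe_coe, PowerSeries.coeff_C_mul, PowerSeries.coeff_map]

/-- Lemma 6.4: if `L₀ ∩ L₁ = ∅ = K₀ ∩ K₁`, `|L₀|+|L₁| ≤ s−n`, `|K₀|+|K₁| ≤ s−n` and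
`l ≤ 2(s−n) − |L₀| − |L₁| − |K₀| − |K₁| − 1`, then
`ℱ^l_0(L₀,L₁,K₀,K₁,n) ∈ 𝔯[n+1]` (stated in `l!`-cleared form). -/
theorem F_in_minorIdeal (s n l : ℕ) (L0 L1 K0 K1 : Finset (Fin s))
    (hL : Disjoint L0 L1) (hK : Disjoint K0 K1)
    (hLc : L0.card + L1.card + n ≤ s) (hKc : K0.card + K1.card + n ≤ s)
    (hl : l + L0.card + L1.card + K0.card + K1.card + 1 + 2 * n ≤ 2 * s)
    (g : PolyS s)
    (hg : (l.factorial : ℤ) • g = Fraw s L0 L1 K0 K1 n 0 l) :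
    g ∈ minorIdealS s (n + 1) := by
  rw [eq_sum_of_factorial_smul_eq_Fraw hg, ← Ideal.Quotient.eq_zero_iff_mem]
  exact map_sum_minorA_mul_coeff_taylorSeries hl Ideal.mk_ker.ge
end
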